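/- arXiv:1605.00589 — 2 statements merged into one kernel-verified Lean document; each statement's English description precedes it below -/
import Mathlib

section
/- Local well-posedness of the Boltzmann hierarchy with Gaussian position–velocity weights (Theorem 11.2). Let d ≥ 2 and ℓ > 0. Suppose F_∞(0) = {f_∞^{(s)}(0)}_{s∈ℕ} is a sequence of continuous functions f_∞^{(s)}(0) : ℝ^{2ds} → ℝ, each symmetric under particle interchange, such that for some β_0 > 0 and μ_0 ∈ ℝ: sup_{s∈ℕ} sup_{Z_s} |f_∞^{(s)}(0,Z_s)| e^{β_0 [E_s(Z_s) + I_s(Z_s)]} e^{μ_0 s} ≤ 1. Then there is a constant C_d > 0, depending only on d, such that if T_L < C_d ℓ e^{μ_0} β_0^{(d+1)/2}, there exists a unique sequence F_∞(t) = {f_∞^{(s)}(t)}_{s∈ℕ} of continuous symmetric functions f_∞^{(s)} : [0,T_L] × ℝ^{2ds} → ℝ attaining the given data at t = 0, satisfying sup_{0≤t≤T_L} sup_{s∈ℕ} sup_{Z_s} |f_∞^{(s)}(t,Z_s)| e^{(1/2)β_0 [E_s(Z_s) + I_s((X_s − V_s t, V_s))]} e^{(μ_0−1)s} ≤ 2,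 and solving, for each s, (∂_t + V_s·∇_{X_s}) f_∞^{(s)}(t,Z_s) = ℓ^{−1} (C⁰_{s+1} f_∞^{(s+1)})(t,Z_s) in the sense of distributions for 0 ≤ t ≤ T_L. -/
noncomputable section
open MeasureTheory Real
open scoped InnerProductSpace BigOperators

/-- Euclidean space `ℝ^d`. -/
abbrev Rd (d : ℕ) := EuclideanSpace ℝ (Fin d)

/-- The `s`-particle phase space `(ℝ^d × ℝ^d)^s`. -/
abbrev Phase (d s : ℕ) := Fin s → Rd d × Rd d

/-- The kinetic energy `E_s(Z_s) = (1/2)∑ |v_i|²`. -/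
def energy {d s : ℕ} (Z : Phase d s) : ℝ := (1 / 2) * ∑ i, ‖(Z i).2‖ ^ 2

/-- The moment of inertia `I_s(Z_s) = (1/2)∑ |x_i|²`. -/
def inertia {d s : ℕ} (Z : Phase d s) : ℝ := (1 / 2) * ∑ i, ‖(Z i).1‖ ^ 2

/-- `I_s((X_s − V_s t, V_s)) = (1/2)∑ |x_i − t v_i|²`. -/
def inertiaShift {d s : ℕ} (t : ℝ) (Z : Phase d s) : ℝ :=
  (1 / 2) * ∑ i, ‖(Z i).1 - t • (Z i).2‖ ^ 2

/-- The transport derivative `(∂_t + V_s·∇_{X_s}) φ` of a test function. -/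
def transportD {d s : ℕ} (φ : ℝ → Phase d s → ℝ) (t : ℝ) (Z : Phase d s) : ℝ :=
  deriv (fun h : ℝ => φ (t + h) (fun i => ((Z i).1 + h • (Z i).2, (Z i).2))) 0

/-- The surface measure on the unit sphere of `ℝ^d`. -/
def sphMeas (d : ℕ) : Measure (Metric.sphere (0 : Rd d) 1) :=
  (volume : Measure (Rd d)).toSphere

/-- The Boltzmann hierarchy collision operator `C⁰_{s+1}` acting on a function of
`s+1` particles, evaluated at an `s`-particle configuration. -/
def BoltzCollOp (d s : ℕ) (g : Phase d (s + 1) → ℝ) (Z : Phase d s) : ℝ :=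
  ∑ i : Fin s,
    ∫ w : Rd d,
      ∫ ω : Metric.sphere (0 : Rd d) 1,
        (max ⟪(ω : Rd d), w - (Z i).2⟫_ℝ 0 *
            g (Fin.snoc
                (Function.update Z i
                  ((Z i).1, (Z i).2 + ⟪(ω : Rd d), w - (Z i).2⟫_ℝ • (ω : Rd d)))
                ((Z i).1, w - ⟪(ω : Rd d), w - (Z i).2⟫_ℝ • (ω : Rd d)))
          - max (-⟪(ω : Rd d), w - (Z i).2⟫_ℝ) 0 *
              g (Fin.snoc Z ((Z i).1, w))) ∂(sphMeas d)

/-- The family `f` solves the Boltzmann hierarchy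
`(∂_t + V_s·∇_{X_s}) f^{(s)} = ℓ⁻¹ C⁰_{s+1} f^{(s+1)}` in the sense of distributions
on `S × ℝ^{2ds}`, `S` being an open set of times. -/
def SolvesBoltzmannHierarchy (d : ℕ) (ℓ : ℝ) (S : Set ℝ)
    (f : (s : ℕ) → ℝ → Phase d s → ℝ) : Prop :=
  ∀ s : ℕ, 1 ≤ s → ∀ φ : ℝ → Phase d s → ℝ,
    ContDiff ℝ 1 (Function.uncurry φ) →
    HasCompactSupport (Function.uncurry φ) →
    (∀ t : ℝ, t ∉ S → ∀ Z, φ t Z = 0) →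
    (∫ t in S, ∫ Z : Phase d s,
      (transportD φ t Z * f s t Z
        + ℓ⁻¹ * φ t Z * BoltzCollOp d s (f (s + 1) t) Z)) = 0

/-- The properties required of the local solution in Theorem 11.2: continuity on
`[0,T_L]`, symmetry, attainment of the initial data, the weighted bound with the
Gaussian position–velocity (shifted inertia) weight, and the Boltzmann hierarchy in
distributions on `(0,T_L)`. -/
def GoodLocalSol (d : ℕ) (ℓ T β₀ μ₀ : ℝ) (f₀ : (s : ℕ) → Phase d s → ℝ)
    (f : (s : ℕ) → ℝ → Phase d s → ℝ) : Prop :=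
  (∀ s : ℕ, ContinuousOn (Function.uncurry (f s))
      (Set.Icc (0 : ℝ) T ×ˢ (Set.univ : Set (Phase d s)))) ∧
  (∀ s : ℕ, ∀ σ : Equiv.Perm (Fin s), ∀ t : ℝ, ∀ Z : Phase d s,
      f s t (Z ∘ σ) = f s t Z) ∧
  (∀ s : ℕ, ∀ Z : Phase d s, f s 0 Z = f₀ s Z) ∧
  (∀ t ∈ Set.Icc (0 : ℝ) T, ∀ s : ℕ, 1 ≤ s → ∀ Z : Phase d s,
      |f s t Z| * exp ((1 / 2) * β₀ * (energy Z + inertiaShift t Z)) *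
          exp ((μ₀ - 1) * s) ≤ 2) ∧
  SolvesBoltzmannHierarchy d ℓ (Set.Ioo (0 : ℝ) T) f

/-! ### Free transport -/

/-- Free transport of all particles for a time `t`. -/
def freeFlow {d s : ℕ} (t : ℝ) (Z : Phase d s) : Phase d s :=
  fun i => ((Z i).1 + t • (Z i).2, (Z i).2)

/-- The weight `E_s + I_s((X_s - V_s t, V_s))`. -/
def shiftedWeight {d s : ℕ} (t : ℝ) (Z : Phase d s) : ℝ := energy Z + inertiaShift t Z

lemma freeFlow_freeFlow {d s : ℕ} (a b : ℝ) (Z : Phase d s) :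
    freeFlow a (freeFlow b Z) = freeFlow (b + a) Z := by
  funext i
  simp [freeFlow, add_smul, add_assoc]

@[simp]
lemma freeFlow_zero {d s : ℕ} (Z : Phase d s) : freeFlow 0 Z = Z := by
  funext i
  simp [freeFlow]

@[simp]
lemma freeFlow_neg_freeFlow {d s : ℕ} (t : ℝ) (Z : Phase d s) :
    freeFlow (-t) (freeFlow t Z) = Z := by
  simp [freeFlow_freeFlow]

@[simp]
lemma freeFlow_freeFlow_neg {d s : ℕ} (t : ℝ) (Z : Phase d s) :
    freeFlow t (freeFlow (-t) Z) = Z := by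
  simp [freeFlow_freeFlow]

lemma freeFlow_comp_perm {d s : ℕ} (t : ℝ) (Z : Phase d s) (σ : Equiv.Perm (Fin s)) :
    freeFlow t (Z ∘ σ) = freeFlow t Z ∘ σ := rfl

lemma contDiff_freeFlow {d s : ℕ} :
    ContDiff ℝ 1 (fun p : ℝ × Phase d s => freeFlow p.1 p.2) := by
  unfold freeFlow
  fun_prop

lemma Continuous.freeFlow {X : Type*} [TopologicalSpace X] {d s : ℕ} {a : X → ℝ}
    {b : X → Phase d s} (ha : Continuous a) (hb : Continuous b) :
    Continuous (fun x => freeFlow (a x) (b x)) :=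
  contDiff_freeFlow.continuous.comp (ha.prodMk hb)

/-- Free transport as a homeomorphism of phase space. -/
def freeFlowHomeomorph (d s : ℕ) (t : ℝ) : Phase d s ≃ₜ Phase d s where
  toFun := freeFlow t
  invFun := freeFlow (-t)
  left_inv := freeFlow_neg_freeFlow t
  right_inv := freeFlow_freeFlow_neg t
  continuous_toFun := continuous_const.freeFlow continuous_id
  continuous_invFun := continuous_const.freeFlow continuous_id

lemma measurePreserving_shear {d : ℕ} (t : ℝ) :
    MeasurePreserving (fun z : Rd d × Rd d => (z.1 + t • z.2, z.2)) volume volume := by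
  have h : MeasurePreserving (fun p : Rd d × Rd d => (p.1, p.2 + t • p.1))
      (volume.prod volume) (volume.prod volume) := by
    refine (MeasurePreserving.id volume).skew_product
      (g := fun (v x : Rd d) => x + t • v) (by fun_prop) (Filter.Eventually.of_forall fun v => ?_)
    exact (measurePreserving_add_right volume (t • v)).map_eq
  exact (Measure.measurePreserving_swap.comp h).comp Measure.measurePreserving_swap

lemma measurePreserving_freeFlow {d s : ℕ} (t : ℝ) :
    MeasurePreserving (freeFlow t : Phase d s → Phase d s) volume volume :=
  volume_preserving_pi (f := fun (_ : Fin s) (z : Rd d × Rd d) => (z.1 + t • z.2, z.2))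
    fun _ => measurePreserving_shear t

lemma integral_comp_freeFlow {d s : ℕ} (t : ℝ) (K : Phase d s → ℝ) :
    ∫ Z, K (freeFlow t Z) = ∫ Z, K Z :=
  (measurePreserving_freeFlow t).integral_comp
    (freeFlowHomeomorph d s t).measurableEmbedding K

lemma shiftedWeight_freeFlow {d s : ℕ} (t : ℝ) (Z : Phase d s) :
    shiftedWeight t (freeFlow t Z) = shiftedWeight 0 Z := by
  simp [shiftedWeight, energy, inertiaShift, freeFlow]

lemma shiftedWeight_zero {d s : ℕ} (Z : Phase d s) :
    shiftedWeight 0 Z = energy Z + inertia Z := by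
  simp [shiftedWeight, inertiaShift, inertia]

lemma shiftedWeight_zero_freeFlow_neg {d s : ℕ} (t : ℝ) (Z : Phase d s) :
    shiftedWeight 0 (freeFlow (-t) Z) = shiftedWeight t Z := by
  rw [← shiftedWeight_freeFlow t, freeFlow_freeFlow_neg]

lemma shiftedWeight_eq_sum {d s : ℕ} (t : ℝ) (Z : Phase d s) :
    shiftedWeight t Z = ∑ i, (1 / 2) * (‖(Z i).2‖ ^ 2 + ‖(Z i).1 - t • (Z i).2‖ ^ 2) := by
  simp only [shiftedWeight, energy, inertiaShift, ← Finset.mul_sum, Finset.sum_add_distrib]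
  ring

lemma energy_nonneg {d s : ℕ} (Z : Phase d s) : 0 ≤ energy Z := by
  unfold energy
  positivity

lemma inertiaShift_nonneg {d s : ℕ} (t : ℝ) (Z : Phase d s) : 0 ≤ inertiaShift t Z := by
  unfold inertiaShift
  positivity

lemma shiftedWeight_nonneg {d s : ℕ} (t : ℝ) (Z : Phase d s) : 0 ≤ shiftedWeight t Z :=
  add_nonneg (energy_nonneg Z) (inertiaShift_nonneg t Z)

lemma continuous_shiftedWeight_zero {d s : ℕ} :
    Continuous (shiftedWeight 0 : Phase d s → ℝ) := by
  unfold shiftedWeight energy inertiaShift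
  fun_prop

/-! ### Binary collisions -/

/-- The `s + 1` particle configuration obtained from `Z` by adjoining a particle of velocity `w`
at the position of particle `i` and colliding the two with impact direction `ω`. -/
def postCollision {d s : ℕ} (Z : Phase d s) (i : Fin s) (w ω : Rd d) : Phase d (s + 1) :=
  Fin.snoc
    (Function.update Z i ((Z i).1, (Z i).2 + ⟪ω, w - (Z i).2⟫_ℝ • ω))
    ((Z i).1, w - ⟪ω, w - (Z i).2⟫_ℝ • ω)

/-- The configuration obtained from `Z` by adjoining a particle of velocity `w` at the position of
particle `i`. -/
def adjoinParticle {d s : ℕ} (Z : Phase d s) (i : Fin s) (w : Rd d) : Phase d (s + 1) :=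
  Fin.snoc Z ((Z i).1, w)

lemma norm_sq_add_norm_sq_reflect {d : ℕ} (a b ω : Rd d) (hω : ‖ω‖ = 1) :
    ‖a + ⟪ω, b - a⟫_ℝ • ω‖ ^ 2 + ‖b - ⟪ω, b - a⟫_ℝ • ω‖ ^ 2 = ‖a‖ ^ 2 + ‖b‖ ^ 2 := by
  rw [norm_add_sq_real, norm_sub_sq_real, inner_smul_right, inner_smul_right, norm_smul, hω,
    inner_sub_right, real_inner_comm ω a, real_inner_comm ω b, mul_one, Real.norm_eq_abs, sq_abs]
  ring

lemma shiftedWeight_snoc {d s : ℕ} (t : ℝ) (Z : Phase d s) (z : Rd d × Rd d) :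
    shiftedWeight t (Fin.snoc Z z : Phase d (s + 1)) =
      shiftedWeight t Z + (1 / 2) * (‖z.2‖ ^ 2 + ‖z.1 - t • z.2‖ ^ 2) := by
  simp [shiftedWeight_eq_sum, Fin.sum_univ_castSucc]

lemma shiftedWeight_update {d s : ℕ} (t : ℝ) (Z : Phase d s) (i : Fin s) (z : Rd d × Rd d) :
    shiftedWeight t (Function.update Z i z) + (1 / 2) * (‖(Z i).2‖ ^ 2 + ‖(Z i).1 - t • (Z i).2‖ ^ 2)
      = shiftedWeight t Z + (1 / 2) * (‖z.2‖ ^ 2 + ‖z.1 - t • z.2‖ ^ 2) := by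
  rw [shiftedWeight_eq_sum, shiftedWeight_eq_sum, ← Finset.add_sum_erase _ _ (Finset.mem_univ i),
    ← Finset.add_sum_erase (Finset.univ) (fun j => (1 / 2) * (‖(Z j).2‖ ^ 2 +
      ‖(Z j).1 - t • (Z j).2‖ ^ 2)) (Finset.mem_univ i)]
  have : ∑ j ∈ Finset.univ.erase i, (1 / 2) * (‖(Function.update Z i z j).2‖ ^ 2 +
      ‖(Function.update Z i z j).1 - t • (Function.update Z i z j).2‖ ^ 2) =
      ∑ j ∈ Finset.univ.erase i, (1 / 2) * (‖(Z j).2‖ ^ 2 + ‖(Z j).1 - t • (Z j).2‖ ^ 2) := by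
    refine Finset.sum_congr rfl fun j hj => ?_
    rw [Function.update_of_ne (Finset.ne_of_mem_erase hj)]
  rw [this, Function.update_self]
  ring

lemma le_shiftedWeight_adjoinParticle {d s : ℕ} (t : ℝ) (Z : Phase d s) (i : Fin s) (w : Rd d) :
    shiftedWeight t Z + (1 / 2) * ‖w‖ ^ 2 ≤ shiftedWeight t (adjoinParticle Z i w) := by
  rw [adjoinParticle, shiftedWeight_snoc]
  have := sq_nonneg ‖(Z i).1 - t • w‖
  simp only
  linarith

lemma shiftedWeight_postCollision {d s : ℕ} (t : ℝ) (Z : Phase d s) (i : Fin s) (w ω : Rd d)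
    (hω : ‖ω‖ = 1) :
    shiftedWeight t (postCollision Z i w ω) = shiftedWeight t (adjoinParticle Z i w) := by
  rw [postCollision, adjoinParticle, shiftedWeight_snoc, shiftedWeight_snoc]
  have h1 := shiftedWeight_update t Z i ((Z i).1, (Z i).2 + ⟪ω, w - (Z i).2⟫_ℝ • ω)
  have h2 := norm_sq_add_norm_sq_reflect (Z i).2 w ω hω
  have h3 := norm_sq_add_norm_sq_reflect ((Z i).1 - t • (Z i).2) ((Z i).1 - t • w) ω hω
  have h4 : ⟪ω, (Z i).1 - t • w - ((Z i).1 - t • (Z i).2)⟫_ℝ = -(t * ⟪ω, w - (Z i).2⟫_ℝ) := by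
    rw [← inner_smul_right, ← inner_neg_right]
    congr 1
    module
  rw [h4] at h3
  have h5 : (Z i).1 - t • (Z i).2 + -(t * ⟪ω, w - (Z i).2⟫_ℝ) • ω =
      (Z i).1 - t • ((Z i).2 + ⟪ω, w - (Z i).2⟫_ℝ • ω) := by module
  have h6 : (Z i).1 - t • w - -(t * ⟪ω, w - (Z i).2⟫_ℝ) • ω =
      (Z i).1 - t • (w - ⟪ω, w - (Z i).2⟫_ℝ • ω) := by module
  rw [h5, h6] at h3
  simp only at h1 ⊢
  linarith

lemma continuous_postCollision {d s : ℕ} (i : Fin s) :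
    Continuous (fun p : Phase d s × Rd d × Rd d => postCollision p.1 i p.2.1 p.2.2) := by
  unfold postCollision
  refine Continuous.finSnoc (A := fun _ => Rd d × Rd d) (Continuous.update (by fun_prop) i ?_) ?_ <;>
  fun_prop

lemma continuous_adjoinParticle {d s : ℕ} (i : Fin s) :
    Continuous (fun p : Phase d s × Rd d => adjoinParticle p.1 i p.2) := by
  unfold adjoinParticle
  refine Continuous.finSnoc (A := fun _ => Rd d × Rd d) ?_ ?_ <;> fun_prop

/-- The permutation of `Fin (s + 1)` extending `σ` and fixing the last element. -/
def extendPerm {s : ℕ} (σ : Equiv.Perm (Fin s)) : Equiv.Perm (Fin (s + 1)) where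
  toFun := Fin.snoc (α := fun _ => Fin (s + 1)) (fun j => (σ j).castSucc) (Fin.last s)
  invFun := Fin.snoc (α := fun _ => Fin (s + 1)) (fun j => (σ.symm j).castSucc) (Fin.last s)
  left_inv := fun j => by refine Fin.lastCases ?_ (fun j => ?_) j <;> simp
  right_inv := fun j => by refine Fin.lastCases ?_ (fun j => ?_) j <;> simp

lemma snoc_comp_perm {d s : ℕ} (Z : Phase d s) (z : Rd d × Rd d) (σ : Equiv.Perm (Fin s)) :
    (Fin.snoc (Z ∘ σ) z : Phase d (s + 1)) = (Fin.snoc Z z : Phase d (s + 1)) ∘ extendPerm σ := by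
  funext j
  refine Fin.lastCases ?_ (fun j => ?_) j <;> simp [extendPerm]

lemma adjoinParticle_comp_perm {d s : ℕ} (Z : Phase d s) (i : Fin s) (w : Rd d)
    (σ : Equiv.Perm (Fin s)) :
    adjoinParticle (Z ∘ σ) i w = adjoinParticle Z (σ i) w ∘ extendPerm σ :=
  snoc_comp_perm _ _ _

lemma postCollision_comp_perm {d s : ℕ} (Z : Phase d s) (i : Fin s) (w ω : Rd d)
    (σ : Equiv.Perm (Fin s)) :
    postCollision (Z ∘ σ) i w ω = postCollision Z (σ i) w ω ∘ extendPerm σ := by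
  rw [postCollision, postCollision, ← snoc_comp_perm]
  congr 1
  funext j
  by_cases h : j = i
  · subst h; simp
  · simp [Function.update_of_ne h, Function.update_of_ne (σ.injective.ne h)]

/-! ### The collision operator on functions with Gaussian decay -/

/-- The integral over impact directions in the collision operator. -/
def angularCollision {d s : ℕ} (g : Phase d (s + 1) → ℝ) (Z : Phase d s) (i : Fin s)
    (w : Rd d) : ℝ :=
  ∫ ω : Metric.sphere (0 : Rd d) 1,
    (max ⟪(ω : Rd d), w - (Z i).2⟫_ℝ 0 * g (postCollision Z i w ω)
      - max (-⟪(ω : Rd d), w - (Z i).2⟫_ℝ) 0 * g (adjoinParticle Z i w)) ∂(sphMeas d)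

lemma boltzCollOp_eq_sum {d s : ℕ} (g : Phase d (s + 1) → ℝ) (Z : Phase d s) :
    BoltzCollOp d s g Z = ∑ i : Fin s, ∫ w : Rd d, angularCollision g Z i w := rfl

/-- The profile dominating the velocity integrand of the collision operator. -/
def gaussProfile {d : ℕ} (w : Rd d) : ℝ := (1 + ‖w‖) * exp (-(1 / 2) * ‖w‖ ^ 2)

/-- The dimensional constant in the collision estimate. -/
def collConst (d : ℕ) : ℝ := (sphMeas d).real Set.univ * ∫ w : Rd d, gaussProfile w

instance (d : ℕ) : IsFiniteMeasure (sphMeas d) := by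
  unfold sphMeas
  infer_instance

lemma gaussProfile_nonneg {d : ℕ} (w : Rd d) : 0 ≤ gaussProfile w := by
  unfold gaussProfile
  positivity

lemma collConst_nonneg (d : ℕ) : 0 ≤ collConst d :=
  mul_nonneg measureReal_nonneg (integral_nonneg gaussProfile_nonneg)

lemma integrable_exp_neg_mul_norm_sq {d : ℕ} {b : ℝ} (hb : 0 < b) :
    Integrable (fun w : Rd d => exp (-b * ‖w‖ ^ 2)) := by
  have h := GaussianFourier.integrable_cexp_neg_mul_sq_norm_add (V := Rd d) (b := (b : ℂ))
    (by simpa using hb) 0 0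
  refine h.norm.congr (Filter.Eventually.of_forall fun w => ?_)
  simp only [Complex.norm_exp, zero_mul, add_zero]
  congr 1
  norm_cast

lemma integrable_gaussProfile (d : ℕ) : Integrable (gaussProfile : Rd d → ℝ) := by
  have h := (integrable_exp_neg_mul_norm_sq (d := d) (b := 1 / 4) (by norm_num)).const_mul 2
  refine h.mono' ?_ (Filter.Eventually.of_forall fun w => ?_)
  · unfold gaussProfile
    exact Continuous.aestronglyMeasurable (by fun_prop)
  · rw [Real.norm_of_nonneg (gaussProfile_nonneg w), gaussProfile]
    have h1 : 1 + ‖w‖ ≤ 2 * exp ((1 / 4) * ‖w‖ ^ 2) := by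
      have h2 := add_one_le_exp ((1 / 4) * ‖w‖ ^ 2)
      nlinarith [sq_nonneg (‖w‖ - 1)]
    calc (1 + ‖w‖) * exp (-(1 / 2) * ‖w‖ ^ 2)
        ≤ 2 * exp ((1 / 4) * ‖w‖ ^ 2) * exp (-(1 / 2) * ‖w‖ ^ 2) := by gcongr
      _ = 2 * exp (-(1 / 4) * ‖w‖ ^ 2) := by
        rw [mul_assoc, ← exp_add]
        congr 2
        ring

lemma integrable_gaussProfile_smul (d : ℕ) {r : ℝ} (hr : 0 < r) :
    Integrable (fun w : Rd d => gaussProfile (r • w)) :=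
  (integrable_gaussProfile d).comp_smul hr.ne'

lemma integral_gaussProfile_smul (d : ℕ) {r : ℝ} (hr : 0 < r) :
    ∫ w : Rd d, gaussProfile (r • w) = (r ^ d)⁻¹ * ∫ w : Rd d, gaussProfile w := by
  rw [Measure.integral_comp_smul, finrank_euclideanSpace_fin, smul_eq_mul, abs_of_pos]
  positivity

lemma norm_add_mul_exp_le_gaussProfile {d : ℕ} {β : ℝ} (hβ : 0 < β) (c : ℝ) (hc : 0 ≤ c)
    (w : Rd d) :
    (‖w‖ + c) * exp (-β * ((1 / 2) * ‖w‖ ^ 2)) ≤ ((√β)⁻¹ + c) * gaussProfile (√β • w) := by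
  have h0 : 0 < √β := sqrt_pos.mpr hβ
  have h1 : ‖√β • w‖ = √β * ‖w‖ := by rw [norm_smul, Real.norm_of_nonneg h0.le]
  have h2 : -(1 / 2) * (√β * ‖w‖) ^ 2 = -β * ((1 / 2) * ‖w‖ ^ 2) := by
    rw [mul_pow, sq_sqrt hβ.le]
    ring
  rw [gaussProfile, h1, h2, ← mul_assoc ((√β)⁻¹ + c)]
  refine mul_le_mul_of_nonneg_right ?_ (exp_pos _).le
  have h3 : (√β)⁻¹ * (√β * ‖w‖) = ‖w‖ := by field_simp
  have h4 : 0 ≤ (√β)⁻¹ := by positivity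
  have h5 : 0 ≤ c * (√β * ‖w‖) := by positivity
  nlinarith

lemma norm_angularCollision_le {d s : ℕ} {g : Phase d (s + 1) → ℝ} {M β t : ℝ} (hβ : 0 < β)
    (hM : 0 ≤ M) (hg : ∀ Z, |g Z| ≤ M * exp (-β * shiftedWeight t Z)) (Z : Phase d s) (i : Fin s)
    (w : Rd d) :
    ‖angularCollision g Z i w‖ ≤ M * exp (-β * shiftedWeight t Z) *
      ((sphMeas d).real Set.univ * (((√β)⁻¹ + ‖(Z i).2‖) * gaussProfile (√β • w))) := by
  set B := M * exp (-β * (shiftedWeight t Z + (1 / 2) * ‖w‖ ^ 2)) with hB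
  have hB0 : 0 ≤ B := by positivity
  have key : ∀ Z' : Phase d (s + 1), shiftedWeight t Z + (1 / 2) * ‖w‖ ^ 2 ≤ shiftedWeight t Z' →
      |g Z'| ≤ B := fun Z' h =>
    (hg Z').trans (mul_le_mul_of_nonneg_left
      (exp_le_exp.mpr (mul_le_mul_of_nonpos_left h (by linarith))) hM)
  have hb : ∀ ω : Metric.sphere (0 : Rd d) 1,
      ‖max ⟪(ω : Rd d), w - (Z i).2⟫_ℝ 0 * g (postCollision Z i w ω)
        - max (-⟪(ω : Rd d), w - (Z i).2⟫_ℝ) 0 * g (adjoinParticle Z i w)‖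
      ≤ (‖w‖ + ‖(Z i).2‖) * B := by
    intro ω
    have hω : ‖(ω : Rd d)‖ = 1 := by simp
    have h1 := key _ (le_shiftedWeight_adjoinParticle t Z i w)
    have h2 := key _ ((le_shiftedWeight_adjoinParticle t Z i w).trans_eq
      (shiftedWeight_postCollision t Z i w ω hω).symm)
    have h3 : |⟪(ω : Rd d), w - (Z i).2⟫_ℝ| ≤ ‖w‖ + ‖(Z i).2‖ := by
      refine (abs_real_inner_le_norm _ _).trans ?_
      rw [hω, one_mul]
      exact norm_sub_le _ _
    set a := ⟪(ω : Rd d), w - (Z i).2⟫_ℝ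
    rw [Real.norm_eq_abs]
    rcases le_total 0 a with ha | ha
    · rw [max_eq_left ha, max_eq_right (by linarith), zero_mul, sub_zero, abs_mul]
      gcongr
    · rw [max_eq_right ha, max_eq_left (by linarith), zero_mul, zero_sub, abs_neg, abs_mul, abs_neg]
      gcongr
  refine (norm_integral_le_of_norm_le_const (Filter.Eventually.of_forall hb)).trans ?_
  have h4 := norm_add_mul_exp_le_gaussProfile hβ ‖(Z i).2‖ (norm_nonneg _) w
  have h5 : B = M * exp (-β * shiftedWeight t Z) * exp (-β * ((1 / 2) * ‖w‖ ^ 2)) := by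
    rw [hB, mul_add, exp_add, mul_assoc]
  calc (‖w‖ + ‖(Z i).2‖) * B * (sphMeas d).real Set.univ
      = M * exp (-β * shiftedWeight t Z) * ((sphMeas d).real Set.univ *
        ((‖w‖ + ‖(Z i).2‖) * exp (-β * ((1 / 2) * ‖w‖ ^ 2)))) := by rw [h5]; ring
    _ ≤ _ := by gcongr

lemma continuous_collisionIntegrand {X : Type*} [TopologicalSpace X] {d s : ℕ}
    {G : X → Phase d (s + 1) → ℝ} (hG : Continuous (Function.uncurry G)) (i : Fin s) :
    Continuous (fun p : (X × Phase d s × Rd d) × Metric.sphere (0 : Rd d) 1 =>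
      (max ⟪(p.2 : Rd d), p.1.2.2 - (p.1.2.1 i).2⟫_ℝ 0 *
          G p.1.1 (postCollision p.1.2.1 i p.1.2.2 p.2)
        - max (-⟪(p.2 : Rd d), p.1.2.2 - (p.1.2.1 i).2⟫_ℝ) 0 *
          G p.1.1 (adjoinParticle p.1.2.1 i p.1.2.2))) := by
  have h1 : Continuous (fun p : (X × Phase d s × Rd d) × Metric.sphere (0 : Rd d) 1 =>
      G p.1.1 (postCollision p.1.2.1 i p.1.2.2 p.2)) :=
    hG.comp ((by fun_prop : Continuous fun p : (X × Phase d s × Rd d) ×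
      Metric.sphere (0 : Rd d) 1 => p.1.1).prodMk ((continuous_postCollision i).comp
        (by fun_prop : Continuous fun p : (X × Phase d s × Rd d) × Metric.sphere (0 : Rd d) 1 =>
          (p.1.2.1, p.1.2.2, (p.2 : Rd d)))))
  have h2 : Continuous (fun p : (X × Phase d s × Rd d) × Metric.sphere (0 : Rd d) 1 =>
      G p.1.1 (adjoinParticle p.1.2.1 i p.1.2.2)) :=
    hG.comp ((by fun_prop : Continuous fun p : (X × Phase d s × Rd d) ×
      Metric.sphere (0 : Rd d) 1 => p.1.1).prodMk ((continuous_adjoinParticle i).comp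
        (by fun_prop : Continuous fun p : (X × Phase d s × Rd d) × Metric.sphere (0 : Rd d) 1 =>
          (p.1.2.1, p.1.2.2))))
  have h3 : Continuous (fun p : (X × Phase d s × Rd d) × Metric.sphere (0 : Rd d) 1 =>
      ⟪(p.2 : Rd d), p.1.2.2 - (p.1.2.1 i).2⟫_ℝ) := by fun_prop
  exact ((h3.max continuous_const).mul h1).sub ((h3.neg.max continuous_const).mul h2)

lemma continuous_angularCollision {d s : ℕ} {G : ℝ → Phase d (s + 1) → ℝ}
    (hG : Continuous (Function.uncurry G)) (i : Fin s) :
    Continuous (fun p : ℝ × Phase d s × Rd d => angularCollision (G p.1) p.2.1 i p.2.2) := by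
  have h := continuous_parametric_integral_of_continuous (μ := sphMeas d)
    (f := fun (p : ℝ × Phase d s × Rd d) (ω : Metric.sphere (0 : Rd d) 1) =>
      (max ⟪(ω : Rd d), p.2.2 - (p.2.1 i).2⟫_ℝ 0 * G p.1 (postCollision p.2.1 i p.2.2 ω)
        - max (-⟪(ω : Rd d), p.2.2 - (p.2.1 i).2⟫_ℝ) 0 * G p.1 (adjoinParticle p.2.1 i p.2.2)))
    (continuous_collisionIntegrand hG i) isCompact_univ
  simpa only [angularCollision, Measure.restrict_univ] using h

lemma continuous_angularCollision_velocity {d s : ℕ} {g : Phase d (s + 1) → ℝ}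
    (hg : Continuous g) (Z : Phase d s) (i : Fin s) :
    Continuous (fun w : Rd d => angularCollision g Z i w) := by
  have h := continuous_angularCollision (G := fun _ => g) (hg.comp continuous_snd) i
  have hw : Continuous fun w : Rd d => ((0 : ℝ), Z, w) := by fun_prop
  simpa only [Function.comp_def] using h.comp hw

lemma integrable_angularCollision {d s : ℕ} {g : Phase d (s + 1) → ℝ} {M β t : ℝ} (hβ : 0 < β)
    (hM : 0 ≤ M) (hgc : Continuous g) (hg : ∀ Z, |g Z| ≤ M * exp (-β * shiftedWeight t Z))
    (Z : Phase d s) (i : Fin s) :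
    Integrable (fun w : Rd d => angularCollision g Z i w) :=
  ((((integrable_gaussProfile_smul d (sqrt_pos.mpr hβ)).const_mul _).const_mul _).const_mul _).mono'
    (continuous_angularCollision_velocity hgc Z i).aestronglyMeasurable
    (Filter.Eventually.of_forall fun w => norm_angularCollision_le hβ hM hg Z i w)

lemma abs_boltzCollOp_le {d s : ℕ} {g : Phase d (s + 1) → ℝ} {M β t : ℝ} (hβ : 0 < β)
    (hM : 0 ≤ M) (hg : ∀ Z, |g Z| ≤ M * exp (-β * shiftedWeight t Z)) (Z : Phase d s) :
    |BoltzCollOp d s g Z| ≤ M * exp (-β * shiftedWeight t Z) *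
      (collConst d * ((√β) ^ d)⁻¹ * ∑ i, ((√β)⁻¹ + ‖(Z i).2‖)) := by
  have h0 : 0 < √β := sqrt_pos.mpr hβ
  rw [boltzCollOp_eq_sum, Finset.mul_sum, Finset.mul_sum]
  refine (Finset.abs_sum_le_sum_abs _ _).trans (Finset.sum_le_sum fun i _ => ?_)
  rw [← Real.norm_eq_abs]
  refine (norm_integral_le_of_norm_le
    ((((integrable_gaussProfile_smul d h0).const_mul _).const_mul _).const_mul _)
    (Filter.Eventually.of_forall fun w => norm_angularCollision_le hβ hM hg Z i w)).trans_eq ?_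
  rw [integral_const_mul, integral_const_mul, integral_const_mul, integral_gaussProfile_smul d h0,
    collConst]
  ring

lemma continuous_boltzCollOp {d s : ℕ} {G : ℝ → Phase d (s + 1) → ℝ} {M β : ℝ} (hβ : 0 < β)
    (hM : 0 ≤ M) (hGc : Continuous (Function.uncurry G))
    (hG : ∀ t Z, |G t Z| ≤ M * exp (-β * shiftedWeight t Z)) :
    Continuous (fun p : ℝ × Phase d s => BoltzCollOp d s (G p.1) p.2) := by
  simp only [boltzCollOp_eq_sum]
  refine continuous_finsetSum _ fun i _ => continuous_iff_continuousAt.mpr fun p₀ => ?_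
  have hbd : ∀ᶠ p : ℝ × Phase d s in nhds p₀, ‖(p.2 i).2‖ < ‖(p₀.2 i).2‖ + 1 := by
    refine Filter.Tendsto.eventually_lt_const (lt_add_one _) ?_
    exact (by fun_prop : Continuous fun p : ℝ × Phase d s => ‖(p.2 i).2‖).tendsto p₀
  refine continuousAt_of_dominated
    (bound := fun w => M * ((sphMeas d).real Set.univ *
      (((√β)⁻¹ + (‖(p₀.2 i).2‖ + 1)) * gaussProfile (√β • w))))
    (Filter.Eventually.of_forall fun p => ?_) (hbd.mono fun p hp => ?_)
    ((((integrable_gaussProfile_smul d (sqrt_pos.mpr hβ)).const_mul _).const_mul _).const_mul _)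
    (Filter.Eventually.of_forall fun w => ?_)
  · exact (continuous_angularCollision_velocity
      (hGc.comp (continuous_const.prodMk continuous_id)) p.2 i).aestronglyMeasurable
  · refine Filter.Eventually.of_forall fun w =>
      (norm_angularCollision_le hβ hM (hG p.1) p.2 i w).trans ?_
    have h1 : M * exp (-β * shiftedWeight p.1 p.2) ≤ M := by
      refine mul_le_of_le_one_right hM (exp_le_one_iff.mpr ?_)
      have := mul_nonneg hβ.le (shiftedWeight_nonneg p.1 p.2)
      linarith
    have := gaussProfile_nonneg (√β • w)
    gcongr
  · exact ((continuous_angularCollision hGc i).comp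
      (by fun_prop : Continuous fun p : ℝ × Phase d s => (p.1, p.2, w))).continuousAt

lemma angularCollision_sub {d s : ℕ} {g h : Phase d (s + 1) → ℝ} (hg : Continuous g)
    (hh : Continuous h) (Z : Phase d s) (i : Fin s) (w : Rd d) :
    angularCollision (fun Z' => g Z' - h Z') Z i w =
      angularCollision g Z i w - angularCollision h Z i w := by
  have key : ∀ k : Phase d (s + 1) → ℝ, Continuous k → Integrable
      (fun ω : Metric.sphere (0 : Rd d) 1 =>
        max ⟪(ω : Rd d), w - (Z i).2⟫_ℝ 0 * k (postCollision Z i w ω)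
        - max (-⟪(ω : Rd d), w - (Z i).2⟫_ℝ) 0 * k (adjoinParticle Z i w)) (sphMeas d) := by
    intro k hk
    refine Continuous.integrable_of_hasCompactSupport ?_ (HasCompactSupport.of_compactSpace _)
    have h := continuous_collisionIntegrand (X := ℝ) (G := fun _ => k) (hk.comp continuous_snd) i
    have hω : Continuous fun ω : Metric.sphere (0 : Rd d) 1 => (((0 : ℝ), Z, w), ω) := by fun_prop
    simpa only [Function.comp_def] using h.comp hω
  rw [angularCollision, angularCollision, angularCollision, ← integral_sub (key g hg) (key h hh)]
  refine integral_congr_ae (Filter.Eventually.of_forall fun ω => ?_)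
  ring

lemma boltzCollOp_sub {d s : ℕ} {g h : Phase d (s + 1) → ℝ} {M N β t : ℝ} (hβ : 0 < β)
    (hM : 0 ≤ M) (hN : 0 ≤ N) (hgc : Continuous g) (hhc : Continuous h)
    (hg : ∀ Z, |g Z| ≤ M * exp (-β * shiftedWeight t Z))
    (hh : ∀ Z, |h Z| ≤ N * exp (-β * shiftedWeight t Z)) (Z : Phase d s) :
    BoltzCollOp d s (fun Z' => g Z' - h Z') Z = BoltzCollOp d s g Z - BoltzCollOp d s h Z := by
  simp only [boltzCollOp_eq_sum, ← Finset.sum_sub_distrib]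
  refine Finset.sum_congr rfl fun i _ => ?_
  rw [← integral_sub (integrable_angularCollision hβ hM hgc hg Z i)
    (integrable_angularCollision hβ hN hhc hh Z i)]
  simp only [angularCollision_sub hgc hhc]

lemma boltzCollOp_comp_perm {d s : ℕ} {g : Phase d (s + 1) → ℝ}
    (hg : ∀ (σ : Equiv.Perm (Fin (s + 1))) (Z : Phase d (s + 1)), g (Z ∘ σ) = g Z)
    (σ : Equiv.Perm (Fin s)) (Z : Phase d s) :
    BoltzCollOp d s g (Z ∘ σ) = BoltzCollOp d s g Z := by
  simp only [boltzCollOp_eq_sum]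
  rw [← Equiv.sum_comp σ (fun i => ∫ w : Rd d, angularCollision g Z i w)]
  refine Finset.sum_congr rfl fun i _ => ?_
  simp only [angularCollision, postCollision_comp_perm, adjoinParticle_comp_perm, hg,
    Function.comp_apply]

/-! ### The collision operator in the interaction picture -/

/-- The collision operator conjugated by free transport. -/
def interactionCollision {d s : ℕ} (τ : ℝ) (H : Phase d (s + 1) → ℝ) (Z : Phase d s) : ℝ :=
  BoltzCollOp d s (fun Z' => H (freeFlow (-τ) Z')) (freeFlow τ Z)

lemma abs_comp_freeFlow_neg_le {d s : ℕ} {H : Phase d s → ℝ} {M β : ℝ}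
    (hH : ∀ Z, |H Z| ≤ M * exp (-β * shiftedWeight 0 Z)) (τ : ℝ) (Z : Phase d s) :
    |H (freeFlow (-τ) Z)| ≤ M * exp (-β * shiftedWeight τ Z) := by
  have h := hH (freeFlow (-τ) Z)
  rwa [shiftedWeight_zero_freeFlow_neg] at h

lemma continuous_interactionCollision {d s : ℕ} {H : ℝ → Phase d (s + 1) → ℝ} {M β : ℝ}
    (hβ : 0 < β) (hM : 0 ≤ M) (hHc : Continuous (Function.uncurry H))
    (hH : ∀ τ Z, |H τ Z| ≤ M * exp (-β * shiftedWeight 0 Z)) :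
    Continuous (fun p : ℝ × Phase d s => interactionCollision p.1 (H p.1) p.2) := by
  have hG : Continuous (Function.uncurry fun (τ : ℝ) (Z : Phase d (s + 1)) =>
      H τ (freeFlow (-τ) Z)) :=
    hHc.comp (continuous_fst.prodMk (continuous_fst.neg.freeFlow continuous_snd))
  have h := continuous_boltzCollOp hβ hM hG fun τ Z => abs_comp_freeFlow_neg_le (hH τ) τ Z
  have h' : Continuous fun p : ℝ × Phase d s => (p.1, freeFlow p.1 p.2) :=
    continuous_fst.prodMk (continuous_fst.freeFlow continuous_snd)
  simpa only [interactionCollision, Function.comp_def] using h.comp h'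

lemma abs_interactionCollision_le {d s : ℕ} {H : Phase d (s + 1) → ℝ} {M β : ℝ} (hβ : 0 < β)
    (hM : 0 ≤ M) (hH : ∀ Z, |H Z| ≤ M * exp (-β * shiftedWeight 0 Z)) (τ : ℝ) (Z : Phase d s) :
    |interactionCollision τ H Z| ≤ M * exp (-β * shiftedWeight 0 Z) *
      (collConst d * ((√β) ^ d)⁻¹ * ∑ i, ((√β)⁻¹ + ‖(Z i).2‖)) := by
  have h := abs_boltzCollOp_le hβ hM (abs_comp_freeFlow_neg_le hH τ) (freeFlow τ Z)
  rwa [shiftedWeight_freeFlow] at h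

lemma interactionCollision_sub {d s : ℕ} {H K : Phase d (s + 1) → ℝ} {M N β : ℝ} (hβ : 0 < β)
    (hM : 0 ≤ M) (hN : 0 ≤ N) (hHc : Continuous H) (hKc : Continuous K)
    (hH : ∀ Z, |H Z| ≤ M * exp (-β * shiftedWeight 0 Z))
    (hK : ∀ Z, |K Z| ≤ N * exp (-β * shiftedWeight 0 Z)) (τ : ℝ) (Z : Phase d s) :
    interactionCollision τ (fun Z' => H Z' - K Z') Z =
      interactionCollision τ H Z - interactionCollision τ K Z := by
  have hflow : Continuous (freeFlow (-τ) : Phase d (s + 1) → Phase d (s + 1)) :=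
    continuous_const.freeFlow continuous_id
  exact boltzCollOp_sub hβ hM hN (hHc.comp hflow) (hKc.comp hflow)
    (abs_comp_freeFlow_neg_le hH τ) (abs_comp_freeFlow_neg_le hK τ) (freeFlow τ Z)

lemma interactionCollision_comp_perm {d s : ℕ} {H : Phase d (s + 1) → ℝ}
    (hH : ∀ (σ : Equiv.Perm (Fin (s + 1))) (Z : Phase d (s + 1)), H (Z ∘ σ) = H Z)
    (τ : ℝ) (σ : Equiv.Perm (Fin s)) (Z : Phase d s) :
    interactionCollision τ H (Z ∘ σ) = interactionCollision τ H Z := by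
  rw [interactionCollision, freeFlow_comp_perm]
  exact boltzCollOp_comp_perm (fun σ' Z' => by rw [freeFlow_comp_perm, hH]) σ _

/-- The exponent of the time dependent weight, whose parameters decrease from `(b, m)` at time `0`
to `(b / 2, m - 1)` at time `T`. -/
def timeWeight {d : ℕ} (b m T : ℝ) (s : ℕ) (t : ℝ) (Z : Phase d s) : ℝ :=
  b * (1 - t / (2 * T)) * shiftedWeight 0 Z + (m - t / T) * s

lemma sum_inv_add_norm_le {d s : ℕ} {b : ℝ} (hb : 0 < b) (Z : Phase d s) :
    ∑ i, ((√(b / 2))⁻¹ + ‖(Z i).2‖) ≤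
      (√(b / 2))⁻¹ * (3 / 2 * (s + b / 2 * shiftedWeight 0 Z)) := by
  have hr : 0 < √(b / 2) := sqrt_pos.mpr (by positivity)
  have hr2 : √(b / 2) ^ 2 = b / 2 := sq_sqrt (by positivity)
  have h1 : ∀ i, (√(b / 2))⁻¹ + ‖(Z i).2‖ ≤
      (√(b / 2))⁻¹ * (3 / 2 + b / 4 * ‖(Z i).2‖ ^ 2) := by
    intro i
    have h2 : (√(b / 2))⁻¹ + ‖(Z i).2‖ = (√(b / 2))⁻¹ * (1 + √(b / 2) * ‖(Z i).2‖) := by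
      field_simp
    rw [h2]
    refine mul_le_mul_of_nonneg_left ?_ (by positivity)
    have h3 : b / 4 * ‖(Z i).2‖ ^ 2 = (√(b / 2) * ‖(Z i).2‖) ^ 2 / 2 := by
      rw [mul_pow, hr2]
      ring
    rw [h3]
    nlinarith [sq_nonneg (√(b / 2) * ‖(Z i).2‖ - 1)]
  refine (Finset.sum_le_sum fun i _ => h1 i).trans ?_
  rw [← Finset.mul_sum]
  refine mul_le_mul_of_nonneg_left ?_ (by positivity)
  have h4 : ∑ i, (3 / 2 + b / 4 * ‖(Z i).2‖ ^ 2) = 3 / 2 * s + b / 2 * energy Z := by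
    rw [Finset.sum_add_distrib, ← Finset.mul_sum, energy]
    simp
    ring
  rw [h4]
  have h5 : energy Z ≤ shiftedWeight 0 Z := le_add_of_nonneg_right (inertiaShift_nonneg 0 Z)
  have h6 : b / 2 * energy Z ≤ b / 2 * shiftedWeight 0 Z := by gcongr
  have h7 : 0 ≤ b / 2 * shiftedWeight 0 Z :=
    mul_nonneg (by positivity) (shiftedWeight_nonneg 0 Z)
  linarith

lemma integral_mul_exp_le {K T t : ℝ} (hT : 0 < T) :
    ∫ τ in (0 : ℝ)..t, K * exp (-((t - τ) / T * K)) ≤ T := by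
  have h : ∀ τ ∈ Set.uIcc 0 t, HasDerivAt (fun τ => T * exp (-((t - τ) / T * K)))
      (K * exp (-((t - τ) / T * K))) τ := by
    intro τ _
    have h1 : HasDerivAt (fun τ => -((t - τ) / T * K)) (K / T) τ := by
      have h2 := ((((hasDerivAt_id τ).const_sub t).div_const T).mul_const K).neg
      refine h2.congr_deriv ?_
      field_simp
    have h3 := h1.exp.const_mul T
    refine h3.congr_deriv ?_
    field_simp
  rw [intervalIntegral.integral_eq_sub_of_hasDerivAt h
    (Continuous.intervalIntegrable (by fun_prop) _ _)]
  have : 0 ≤ T * exp (-((t - 0) / T * K)) := by positivity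
  simp only [sub_self, zero_div, zero_mul, neg_zero, exp_zero, mul_one]
  linarith

lemma abs_interactionCollision_le_timeWeight {d s : ℕ} {T b m M t τ : ℝ} (hT : 0 < T) (hb : 0 < b)
    (hM : 0 ≤ M) {H : Phase d (s + 1) → ℝ} (hτt : τ ≤ t) (htT : t ≤ T)
    (hH : ∀ Z, |H Z| ≤ M * exp (-timeWeight b m T (s + 1) τ Z)) (Z : Phase d s) :
    |interactionCollision τ H Z| ≤
      M * exp (-timeWeight b m T s t Z) * (3 / 2 * collConst d * exp (1 - m) *
        (√(b / 2) ^ (d + 1))⁻¹) * ((s + b / 2 * shiftedWeight 0 Z) *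
          exp (-((t - τ) / T * (s + b / 2 * shiftedWeight 0 Z)))) := by
  have hτT : τ / T ≤ 1 := (div_le_one hT).mpr (hτt.trans htT)
  have hτ2T : τ / (2 * T) = τ / T / 2 := by field_simp
  set β := b * (1 - τ / (2 * T)) with hβdef
  have hβ2 : b / 2 ≤ β := by
    rw [hβdef, hτ2T]
    nlinarith
  have hβ : 0 < β := by linarith
  have hr : 0 < √(b / 2) := sqrt_pos.mpr (by positivity)
  have hrβ : √(b / 2) ≤ √β := sqrt_le_sqrt hβ2
  set W := shiftedWeight 0 Z with hW
  have hW0 : 0 ≤ W := shiftedWeight_nonneg 0 Z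
  have h1 : ∀ Z, |H Z| ≤ M * exp (-(m - τ / T) * (s + 1)) * exp (-β * shiftedWeight 0 Z) := by
    intro Z'
    refine (hH Z').trans_eq ?_
    rw [mul_assoc, ← exp_add, timeWeight]
    congr 2
    push_cast
    ring
  refine (abs_interactionCollision_le hβ (by positivity) h1 τ Z).trans ?_
  have h2 : ((√β) ^ d)⁻¹ * ∑ i, ((√β)⁻¹ + ‖(Z i).2‖) ≤
      (√(b / 2) ^ (d + 1))⁻¹ * (3 / 2 * (s + b / 2 * W)) := by
    calc ((√β) ^ d)⁻¹ * ∑ i, ((√β)⁻¹ + ‖(Z i).2‖)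
        ≤ (√(b / 2) ^ d)⁻¹ * ∑ i, ((√(b / 2))⁻¹ + ‖(Z i).2‖) := by gcongr
      _ ≤ (√(b / 2) ^ d)⁻¹ * ((√(b / 2))⁻¹ * (3 / 2 * (s + b / 2 * W))) := by
        refine mul_le_mul_of_nonneg_left (sum_inv_add_norm_le hb Z) (by positivity)
      _ = _ := by
        rw [pow_succ, mul_inv]
        ring
  have h3 : exp (-(m - τ / T) * (s + 1)) * exp (-β * W) ≤
      exp (-timeWeight b m T s t Z) * exp (1 - m) * exp (-((t - τ) / T * (s + b / 2 * W))) := by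
    rw [← exp_add, ← exp_add, ← exp_add]
    refine exp_le_exp.mpr ?_
    have h4 : -timeWeight b m T s t Z + (1 - m) + -((t - τ) / T * (s + b / 2 * W)) -
        (-(m - τ / T) * (s + 1) + -β * W) = 1 - τ / T := by
      rw [timeWeight, hβdef, ← hW]
      field_simp
      ring
    linarith
  have hC := collConst_nonneg d
  calc M * exp (-(m - τ / T) * (s + 1)) * exp (-β * W) *
      (collConst d * ((√β) ^ d)⁻¹ * ∑ i, ((√β)⁻¹ + ‖(Z i).2‖))
      = M * (exp (-(m - τ / T) * (s + 1)) * exp (-β * W)) *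
      (collConst d * (((√β) ^ d)⁻¹ * ∑ i, ((√β)⁻¹ + ‖(Z i).2‖))) := by ring
    _ ≤ M * (exp (-timeWeight b m T s t Z) * exp (1 - m) *
        exp (-((t - τ) / T * (s + b / 2 * W)))) *
      (collConst d * ((√(b / 2) ^ (d + 1))⁻¹ * (3 / 2 * (s + b / 2 * W)))) := by
        have : 0 ≤ ∑ i, ((√β)⁻¹ + ‖(Z i).2‖) := Finset.sum_nonneg fun i _ => by positivity
        gcongr
    _ = _ := by ring

/-- The contraction estimate for the Duhamel term in the time dependent weights. -/
lemma abs_duhamel_le {d s : ℕ} {ℓ T b m M : ℝ} (hℓ : 0 < ℓ) (hT : 0 < T) (hb : 0 < b) (hM : 0 ≤ M)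
    (hsmall : 3 * collConst d * exp (1 - m) * T ≤ ℓ * √(b / 2) ^ (d + 1))
    {H : ℝ → Phase d (s + 1) → ℝ}
    (hH : ∀ τ ∈ Set.Icc 0 T, ∀ Z, |H τ Z| ≤ M * exp (-timeWeight b m T (s + 1) τ Z))
    {t : ℝ} (ht : t ∈ Set.Icc 0 T) (Z : Phase d s) :
    |ℓ⁻¹ * ∫ τ in (0 : ℝ)..t, interactionCollision τ (H τ) Z| ≤
      M / 2 * exp (-timeWeight b m T s t Z) := by
  have hr : 0 < √(b / 2) := sqrt_pos.mpr (by positivity)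
  set K := (s : ℝ) + b / 2 * shiftedWeight 0 Z with hK
  set A := M * exp (-timeWeight b m T s t Z) * (3 / 2 * collConst d * exp (1 - m) *
        (√(b / 2) ^ (d + 1))⁻¹) with hA
  have hA0 : 0 ≤ A := by
    have hC := collConst_nonneg d
    positivity
  have h1 : |∫ τ in (0 : ℝ)..t, interactionCollision τ (H τ) Z| ≤
      ∫ τ in (0 : ℝ)..t, A * (K * exp (-((t - τ) / T * K))) := by
    rw [← Real.norm_eq_abs]
    refine intervalIntegral.norm_integral_le_of_norm_le ht.1
      (Filter.Eventually.of_forall fun τ hτ => ?_)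
      (Continuous.intervalIntegrable (by fun_prop) _ _)
    exact abs_interactionCollision_le_timeWeight hT hb hM hτ.2 ht.2
      (hH τ ⟨hτ.1.le, hτ.2.trans ht.2⟩) Z
  rw [intervalIntegral.integral_const_mul] at h1
  have h2 : |∫ τ in (0 : ℝ)..t, interactionCollision τ (H τ) Z| ≤ A * T :=
    h1.trans (mul_le_mul_of_nonneg_left (integral_mul_exp_le hT) hA0)
  rw [abs_mul, abs_of_pos (inv_pos.mpr hℓ)]
  calc ℓ⁻¹ * |∫ τ in (0 : ℝ)..t, interactionCollision τ (H τ) Z| ≤ ℓ⁻¹ * (A * T) := by gcongr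
    _ = M / 2 * exp (-timeWeight b m T s t Z) *
        ((3 * collConst d * exp (1 - m) * T) / (ℓ * √(b / 2) ^ (d + 1))) := by
      rw [hA]
      field_simp
    _ ≤ M / 2 * exp (-timeWeight b m T s t Z) * 1 := by
      gcongr
      exact (div_le_one (by positivity)).mpr hsmall
    _ = _ := mul_one _

/-! ### Distributional and integrated forms of the transport equation -/

instance isLocallyFiniteMeasure_phase (d s : ℕ) :
    IsLocallyFiniteMeasure (volume : Measure (Phase d s)) :=
  Measure.pi.isLocallyFiniteMeasure (μ := fun _ : Fin s => (volume : Measure (Rd d × Rd d)))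

instance isOpenPosMeasure_phase (d s : ℕ) :
    Measure.IsOpenPosMeasure (volume : Measure (Phase d s)) :=
  Measure.pi.isOpenPosMeasure (fun _ : Fin s => (volume : Measure (Rd d × Rd d)))

lemma hasCompactSupport_mul_add_mul {X : Type*} [TopologicalSpace X] {a b u v : X → ℝ}
    (ha : HasCompactSupport a) (hb : HasCompactSupport b) :
    HasCompactSupport fun x => a x * u x + b x * v x :=
  (ha.mul_right (f' := u)).add (hb.mul_right (f' := v))

/-- Free transport as a homeomorphism of space-time. -/
def spaceTimeFlow (d s : ℕ) : ℝ × Phase d s ≃ₜ ℝ × Phase d s where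
  toFun p := (p.1, freeFlow p.1 p.2)
  invFun p := (p.1, freeFlow (-p.1) p.2)
  left_inv p := by simp
  right_inv p := by simp
  continuous_toFun := continuous_fst.prodMk (continuous_fst.freeFlow continuous_snd)
  continuous_invFun := continuous_fst.prodMk (continuous_fst.neg.freeFlow continuous_snd)

lemma transportD_freeFlow {d s : ℕ} (φ : ℝ → Phase d s → ℝ) (t : ℝ) (Z : Phase d s) :
    transportD φ t (freeFlow t Z) = deriv (fun τ => φ τ (freeFlow τ Z)) t := by
  have h : (fun h : ℝ => φ (t + h) (freeFlow h (freeFlow t Z))) =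
      fun h => (fun τ => φ τ (freeFlow τ Z)) (t + h) := by
    funext h
    rw [freeFlow_freeFlow]
  have h2 := deriv_comp_const_add (fun τ => φ τ (freeFlow τ Z)) t 0
  rw [add_zero] at h2
  rw [← h2, ← h]
  rfl

lemma integral_transport_eq {d s : ℕ} (φ F G : ℝ → Phase d s → ℝ) (t : ℝ) :
    ∫ Z, (transportD φ t Z * F t (freeFlow (-t) Z) + φ t Z * G t (freeFlow (-t) Z)) =
      ∫ Z, (deriv (fun τ => φ τ (freeFlow τ Z)) t * F t Z + φ t (freeFlow t Z) * G t Z) := by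
  rw [← integral_comp_freeFlow t]
  simp only [transportD_freeFlow, freeFlow_neg_freeFlow]

lemma integral_deriv_mul_primitive_eq_zero {T c : ℝ} (hT : 0 ≤ T) {a g : ℝ → ℝ}
    (ha : ContDiff ℝ 1 a) (ha0 : a 0 = 0) (haT : a T = 0) (hg : Continuous g) :
    ∫ t in Set.Ioo 0 T, (deriv a t * (c + ∫ τ in (0 : ℝ)..t, g τ) + a t * g t) = 0 := by
  rw [← integral_Ioc_eq_integral_Ioo, ← intervalIntegral.integral_of_le hT,
    intervalIntegral.integral_deriv_mul_eq_sub (u := a) (v := fun t => c + ∫ τ in (0 : ℝ)..t, g τ)]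
  · simp [ha0, haT]
  · exact fun x _ => (ha.differentiable one_ne_zero x).hasDerivAt
  · exact fun x _ => (hg.integral_hasStrictDerivAt 0 x).hasDerivAt.const_add c
  · exact (ha.continuous_deriv le_rfl).intervalIntegrable _ _
  · exact hg.intervalIntegrable _ _

lemma continuous_primitive {X : Type*} [TopologicalSpace X] [FirstCountableTopology X]
    [LocallyCompactSpace X] {G : ℝ → X → ℝ} (hG : Continuous (Function.uncurry G)) :
    Continuous (fun p : ℝ × X => ∫ τ in (0 : ℝ)..p.1, G τ p.2) := by
  have h : Continuous (Function.uncurry fun (p : ℝ × X) (τ : ℝ) => G τ p.2) :=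
    hG.comp (continuous_snd.prodMk (continuous_snd.comp continuous_fst))
  exact intervalIntegral.continuous_parametric_intervalIntegral_of_continuous h continuous_fst

lemma weak_of_mild {d s : ℕ} {T : ℝ} (hT : 0 < T) {F G : ℝ → Phase d s → ℝ}
    (hF : Continuous (F 0)) (hG : Continuous (Function.uncurry G))
    (hmild : ∀ t ∈ Set.Icc 0 T, ∀ Z, F t Z = F 0 Z + ∫ τ in (0 : ℝ)..t, G τ Z)
    {φ : ℝ → Phase d s → ℝ} (hφ : ContDiff ℝ 1 (Function.uncurry φ))
    (hφc : HasCompactSupport (Function.uncurry φ))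
    (hφ0 : ∀ t, t ∉ Set.Ioo 0 T → ∀ Z, φ t Z = 0) :
    ∫ t in Set.Ioo 0 T, ∫ Z,
      (transportD φ t Z * F t (freeFlow (-t) Z) + φ t Z * G t (freeFlow (-t) Z)) = 0 := by
  set ψ : ℝ × Phase d s → ℝ := fun p => φ p.1 (freeFlow p.1 p.2) with hψdef
  have hψ : ContDiff ℝ 1 ψ := hφ.comp (contDiff_fst.prodMk contDiff_freeFlow)
  have hψc : HasCompactSupport ψ := hφc.comp_homeomorph (spaceTimeFlow d s)
  have hderiv : ∀ t Z, deriv (fun τ => φ τ (freeFlow τ Z)) t = fderiv ℝ ψ (t, Z) (1, 0) := by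
    intro t Z
    have h1 : HasDerivAt (fun τ : ℝ => (τ, Z)) ((1 : ℝ), (0 : Phase d s)) t :=
      (hasDerivAt_id t).prodMk (hasDerivAt_const t Z)
    exact ((hψ.differentiable one_ne_zero (t, Z)).hasFDerivAt.comp_hasDerivAt t h1).deriv
  simp only [integral_transport_eq]
  have hcongr : ∀ t ∈ Set.Ioo 0 T,
      ∫ Z, (deriv (fun τ => φ τ (freeFlow τ Z)) t * F t Z + φ t (freeFlow t Z) * G t Z) =
      ∫ Z, (fderiv ℝ ψ (t, Z) (1, 0) * (F 0 Z + ∫ τ in (0 : ℝ)..t, G τ Z) + ψ (t, Z) * G t Z) := by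
    intro t ht
    simp only [hderiv, ← hmild t ⟨ht.1.le, ht.2.le⟩]
    rfl
  rw [setIntegral_congr_fun measurableSet_Ioo hcongr,
    integral_integral_swap_of_hasCompactSupport]
  · refine integral_eq_zero_of_ae (Filter.Eventually.of_forall fun Z => ?_)
    simp only [← hderiv]
    refine integral_deriv_mul_primitive_eq_zero hT.le ?_ (hφ0 0 (by simp) _) (hφ0 T (by simp) _)
      (hG.comp (continuous_id.prodMk continuous_const))
    exact hψ.comp (contDiff_id.prodMk contDiff_const)
  · have h1 : Continuous fun p : ℝ × Phase d s => fderiv ℝ ψ p (1, 0) :=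
      (hψ.continuous_fderiv one_ne_zero).clm_apply continuous_const
    exact (h1.mul ((hF.comp continuous_snd).add (continuous_primitive hG))).add
      (hψ.continuous.mul hG)
  · have h1 : HasCompactSupport fun p : ℝ × Phase d s => fderiv ℝ ψ p (1, 0) :=
      hψc.fderiv_apply ℝ (1, 0)
    have h2 := hasCompactSupport_mul_add_mul h1 hψc
      (u := fun p => F 0 p.2 + ∫ τ in (0 : ℝ)..p.1, G τ p.2) (v := fun p => G p.1 p.2)
    simpa only [Function.uncurry_def] using h2

lemma eq_of_forall_integral_deriv_mul_eq_zero {T : ℝ} (hT : 0 < T) {e : ℝ → ℝ} (he : Continuous e)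
    (h : ∀ a : ℝ → ℝ, ContDiff ℝ 1 a → (∀ t, t ∉ Set.Ioo 0 T → a t = 0) →
      ∫ t in (0 : ℝ)..T, deriv a t * e t = 0) {t : ℝ} (ht : t ∈ Set.Icc 0 T) : e t = e 0 := by
  set ρ : ℝ → ℝ := fun t => max 0 (t * (T - t)) with hρ
  have hρc : Continuous ρ := by fun_prop
  have hρ0 : ∀ t, 0 ≤ ρ t := fun t => le_max_left _ _
  have hρpos : ∀ t ∈ Set.Ioo 0 T, 0 < ρ t := fun t ht =>
    lt_max_of_lt_right (mul_pos ht.1 (sub_pos.mpr ht.2))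
  have hρneg : ∀ t, t ≤ 0 → ρ t = 0 := fun t ht =>
    max_eq_left (mul_nonpos_of_nonpos_of_nonneg ht (by linarith))
  have hρT : ∀ t, T ≤ t → ρ t = 0 := fun t ht =>
    max_eq_left (mul_nonpos_of_nonneg_of_nonpos (by linarith) (by linarith))
  have hρint : 0 < ∫ t in (0 : ℝ)..T, ρ t :=
    intervalIntegral.integral_pos hT hρc.continuousOn (fun t _ => hρ0 t)
      ⟨T / 2, ⟨by linarith, by linarith⟩, hρpos _ ⟨by linarith, by linarith⟩⟩
  set c := (∫ t in (0 : ℝ)..T, ρ t * e t) / ∫ t in (0 : ℝ)..T, ρ t with hc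
  set θ : ℝ → ℝ := fun t => ρ t * (e t - c) with hθ
  have hθc : Continuous θ := by fun_prop
  have hθint : ∫ t in (0 : ℝ)..T, θ t = 0 := by
    simp only [hθ, mul_sub]
    rw [intervalIntegral.integral_sub
      (Continuous.intervalIntegrable (u := fun t => ρ t * e t) (by fun_prop) _ _)
      (Continuous.intervalIntegrable (u := fun t => ρ t * c) (by fun_prop) _ _), intervalIntegral.integral_mul_const, hc]
    field_simp
    ring
  have hθzero : ∀ t, t ≤ 0 ∨ T ≤ t → θ t = 0 := by
    rintro t (ht | ht)
    · simp [hθ, hρneg t ht]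
    · simp [hθ, hρT t ht]
  have hda : ∀ t, HasDerivAt (fun t => ∫ τ in (0 : ℝ)..t, θ τ) (θ t) t := fun t =>
    (hθc.integral_hasStrictDerivAt 0 t).hasDerivAt
  have hda' : deriv (fun t => ∫ τ in (0 : ℝ)..t, θ τ) = θ := funext fun t => (hda t).deriv
  have hcd : ContDiff ℝ 1 (fun t => ∫ τ in (0 : ℝ)..t, θ τ) := by
    rw [contDiff_one_iff_deriv, hda']
    exact ⟨fun t => (hda t).differentiableAt, hθc⟩
  have hzero : ∀ t, t ∉ Set.Ioo 0 T → ∫ τ in (0 : ℝ)..t, θ τ = 0 := by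
    intro t ht
    rcases le_or_gt t 0 with h0 | h0
    · refine (intervalIntegral.integral_congr (g := fun _ => (0 : ℝ)) fun τ hτ => ?_).trans (by simp)
      rw [Set.uIcc_of_ge h0] at hτ
      exact hθzero τ (Or.inl hτ.2)
    · have hTt : T ≤ t := not_lt.mp fun h => ht ⟨h0, h⟩
      rw [← intervalIntegral.integral_add_adjacent_intervals (hθc.intervalIntegrable 0 T)
        (hθc.intervalIntegrable T t), hθint, zero_add]
      refine (intervalIntegral.integral_congr (g := fun _ => (0 : ℝ)) fun τ hτ => ?_).trans (by simp)
      rw [Set.uIcc_of_le hTt] at hτ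
      exact hθzero τ (Or.inr hτ.1)
  have h1 := h _ hcd hzero
  rw [hda'] at h1
  have h2 : ∫ t in (0 : ℝ)..T, ρ t * (e t - c) ^ 2 = 0 := by
    have h3 : ∀ t, ρ t * (e t - c) ^ 2 = θ t * e t - θ t * c := fun t => by simp only [hθ]; ring
    simp only [h3]
    rw [intervalIntegral.integral_sub
      (Continuous.intervalIntegrable (u := fun t => θ t * e t) (by fun_prop) _ _)
      (Continuous.intervalIntegrable (u := fun t => θ t * c) (by fun_prop) _ _), intervalIntegral.integral_mul_const, h1,
      hθint]
    simp
  have h4 : Set.EqOn e (fun _ => c) (Set.Ioo 0 T) := by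
    intro x hx
    by_contra hne
    refine absurd h2 (ne_of_gt (intervalIntegral.integral_pos hT
      (Continuous.continuousOn (by fun_prop))
      (fun t _ => mul_nonneg (hρ0 t) (sq_nonneg _)) ⟨x, ⟨hx.1.le, hx.2.le⟩, ?_⟩))
    exact mul_pos (hρpos x hx) (sq_pos_of_ne_zero (sub_ne_zero.mpr hne))
  have h5 := h4.closure he continuous_const
  rw [closure_Ioo hT.ne] at h5
  rw [h5 ht, h5 ⟨le_rfl, hT.le⟩]

lemma mild_of_weak {d s : ℕ} {T : ℝ} (hT : 0 < T) {F G : ℝ → Phase d s → ℝ}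
    (hF : Continuous (Function.uncurry F)) (hG : Continuous (Function.uncurry G))
    (hweak : ∀ φ : ℝ → Phase d s → ℝ, ContDiff ℝ 1 (Function.uncurry φ) →
      HasCompactSupport (Function.uncurry φ) → (∀ t, t ∉ Set.Ioo 0 T → ∀ Z, φ t Z = 0) →
      ∫ t in Set.Ioo 0 T, ∫ Z,
        (transportD φ t Z * F t (freeFlow (-t) Z) + φ t Z * G t (freeFlow (-t) Z)) = 0)
    {t : ℝ} (ht : t ∈ Set.Icc 0 T) (Z : Phase d s) :
    F t Z = F 0 Z + ∫ τ in (0 : ℝ)..t, G τ Z := by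
  have hFZ : ∀ Z, Continuous fun t => F t Z := fun Z =>
    hF.comp (continuous_id.prodMk continuous_const)
  have hGZ : ∀ Z, Continuous fun t => G t Z := fun Z =>
    hG.comp (continuous_id.prodMk continuous_const)
  have key : ∀ a : ℝ → ℝ, ContDiff ℝ 1 a → (∀ t, t ∉ Set.Ioo 0 T → a t = 0) → ∀ Z,
      ∫ t in Set.Ioo 0 T, (deriv a t * F t Z + a t * G t Z) = 0 := by
    intro a ha ha0
    have hda := ha.continuous_deriv le_rfl
    have hac : HasCompactSupport a := HasCompactSupport.intro (isCompact_Icc (a := 0) (b := T))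
      fun t ht => ha0 t fun h => ht ⟨h.1.le, h.2.le⟩
    have hJ : Continuous fun p : Phase d s × ℝ => deriv a p.2 * F p.2 p.1 + a p.2 * G p.2 p.1 :=
      ((hda.comp continuous_snd).mul (hF.comp continuous_swap)).add
        ((ha.continuous.comp continuous_snd).mul (hG.comp continuous_swap))
    have hp : Continuous fun Z : Phase d s =>
        ∫ t in Set.Ioo 0 T, (deriv a t * F t Z + a t * G t Z) := by
      simp only [← integral_Ioc_eq_integral_Ioo, ← intervalIntegral.integral_of_le hT.le]
      exact intervalIntegral.continuous_parametric_intervalIntegral_of_continuous'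
        (f := fun (Z : Phase d s) (t : ℝ) => deriv a t * F t Z + a t * G t Z) hJ 0 T
    have hae := ae_eq_zero_of_integral_contDiff_smul_eq_zero
      (μ := (volume : Measure (Phase d s))) hp.locallyIntegrable (fun b hb hbc => by
      set φ : ℝ → Phase d s → ℝ := fun t Z => a t * b (freeFlow (-t) Z) with hφdef
      have hφ : ContDiff ℝ 1 (Function.uncurry φ) :=
        (ha.comp contDiff_fst).mul ((hb.of_le (by exact_mod_cast le_top)).comp
          (contDiff_freeFlow.comp (contDiff_fst.neg.prodMk contDiff_snd)))
      have habc : HasCompactSupport fun p : ℝ × Phase d s => a p.1 * b p.2 :=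
        HasCompactSupport.intro (hac.isCompact.prod hbc.isCompact) fun p hp => by
          by_contra hne
          exact hp ⟨subset_tsupport _ (left_ne_zero_of_mul hne),
            subset_tsupport _ (right_ne_zero_of_mul hne)⟩
      have hφc : HasCompactSupport (Function.uncurry φ) :=
        habc.comp_homeomorph (spaceTimeFlow d s).symm
      have h1 := hweak φ hφ hφc fun t ht Z => by simp [hφdef, ha0 t ht]
      simp only [integral_transport_eq, hφdef, freeFlow_neg_freeFlow, deriv_mul_const_field] at h1
      rw [integral_integral_swap_of_hasCompactSupport] at h1
      · refine Eq.trans ?_ h1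
        refine integral_congr_ae (Filter.Eventually.of_forall fun Z => ?_)
        simp only [smul_eq_mul]
        rw [← integral_const_mul]
        refine integral_congr_ae (Filter.Eventually.of_forall fun t => ?_)
        ring
      · exact (((hda.comp continuous_fst).mul (hb.continuous.comp continuous_snd)).mul hF).add
          (((ha.continuous.comp continuous_fst).mul (hb.continuous.comp continuous_snd)).mul hG)
      · have hdbc : HasCompactSupport fun p : ℝ × Phase d s => deriv a p.1 * b p.2 :=
          HasCompactSupport.intro (hac.deriv.isCompact.prod hbc.isCompact) fun p hp => by
            by_contra hne
            exact hp ⟨subset_tsupport _ (left_ne_zero_of_mul hne),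
              subset_tsupport _ (right_ne_zero_of_mul hne)⟩
        exact hasCompactSupport_mul_add_mul hdbc habc
          (u := Function.uncurry F) (v := Function.uncurry G))
    have := (Continuous.ae_eq_iff_eq volume hp continuous_const).mp hae
    exact fun Z => congrFun this Z
  have hprim : Continuous fun t => ∫ τ in (0 : ℝ)..t, G τ Z :=
    intervalIntegral.continuous_primitive (fun a b => (hGZ Z).intervalIntegrable a b) 0
  have hconst := eq_of_forall_integral_deriv_mul_eq_zero hT
    (e := fun t => F t Z - (F 0 Z + ∫ τ in (0 : ℝ)..t, G τ Z))
    ((hFZ Z).sub (continuous_const.add hprim)) (fun a ha ha0 => by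
      have hda := ha.continuous_deriv le_rfl
      have h1 := key a ha ha0 Z
      have h2 := integral_deriv_mul_primitive_eq_zero (c := F 0 Z) hT.le ha (ha0 0 (by simp))
        (ha0 T (by simp)) (hGZ Z)
      rw [← integral_Ioc_eq_integral_Ioo, ← intervalIntegral.integral_of_le hT.le] at h1 h2
      have hFt := hFZ Z
      have hGt := hGZ Z
      have hac := ha.continuous
      have h3 := intervalIntegral.integral_sub (μ := volume) (a := 0) (b := T)
        (Continuous.intervalIntegrable
          (u := fun t => deriv a t * F t Z + a t * G t Z) (by fun_prop) _ _)
        (Continuous.intervalIntegrable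
          (u := fun t => deriv a t * (F 0 Z + ∫ τ in (0 : ℝ)..t, G τ Z) + a t * G t Z)
          (by fun_prop) _ _)
      rw [h1, h2, sub_zero] at h3
      refine Eq.trans ?_ h3
      refine intervalIntegral.integral_congr fun t _ => ?_
      ring) ht
  simp only [intervalIntegral.integral_same, add_zero, sub_self] at hconst
  linarith

/-! ### Existence of mild solutions -/

lemma shiftedWeight_comp_perm {d s : ℕ} (t : ℝ) (σ : Equiv.Perm (Fin s)) (Z : Phase d s) :
    shiftedWeight t (Z ∘ σ) = shiftedWeight t Z := by
  rw [shiftedWeight_eq_sum, shiftedWeight_eq_sum]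
  exact Equiv.sum_comp σ fun i => (1 / 2) * (‖(Z i).2‖ ^ 2 + ‖(Z i).1 - t • (Z i).2‖ ^ 2)

lemma timeWeight_comp_perm {d s : ℕ} (b m T t : ℝ) (σ : Equiv.Perm (Fin s)) (Z : Phase d s) :
    timeWeight b m T s t (Z ∘ σ) = timeWeight b m T s t Z := by
  rw [timeWeight, timeWeight, shiftedWeight_comp_perm]

lemma Continuous.timeWeight {X : Type*} [TopologicalSpace X] {d s : ℕ} {b m T : ℝ} {u : X → ℝ}
    {z : X → Phase d s} (hu : Continuous u) (hz : Continuous z) :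
    Continuous fun x => timeWeight b m T s (u x) (z x) := by
  have h : Continuous fun x => shiftedWeight 0 (z x) := continuous_shiftedWeight_zero.comp hz
  unfold _root_.timeWeight
  fun_prop

lemma timeWeight_le {d s : ℕ} {b m T t : ℝ} (hT : 0 < T) (hb : 0 ≤ b) (ht : 0 ≤ t)
    (Z : Phase d s) : timeWeight b m T s t Z ≤ b * shiftedWeight 0 Z + m * s := by
  have h1 : 0 ≤ t / (2 * T) * (b * shiftedWeight 0 Z) :=
    mul_nonneg (by positivity) (mul_nonneg hb (shiftedWeight_nonneg 0 Z))
  have h2 : 0 ≤ t / T * s := by positivity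
  rw [timeWeight]
  linarith

lemma le_timeWeight {d s : ℕ} {b m T t : ℝ} (hT : 0 < T) (hb : 0 ≤ b) (ht : t ≤ T)
    (Z : Phase d s) : b / 2 * shiftedWeight 0 Z + (m - 1) * s ≤ timeWeight b m T s t Z := by
  have h0 : t / T ≤ 1 := (div_le_one hT).mpr ht
  have h1 : 0 ≤ (1 - t / T) * (b / 2 * shiftedWeight 0 Z) :=
    mul_nonneg (by linarith) (mul_nonneg (by linarith) (shiftedWeight_nonneg 0 Z))
  have h2 : 0 ≤ (1 - t / T) * s := mul_nonneg (by linarith) (Nat.cast_nonneg s)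
  have h3 : t / (2 * T) = t / T / 2 := by field_simp
  rw [timeWeight, h3]
  linarith

/-- The point of `[0, T]` closest to `t`. -/
def timeClamp (T t : ℝ) : ℝ := max 0 (min t T)

lemma continuous_timeClamp {T : ℝ} : Continuous (timeClamp T) :=
  continuous_const.max (continuous_id.min continuous_const)

lemma timeClamp_mem {T : ℝ} (hT : 0 ≤ T) (t : ℝ) : timeClamp T t ∈ Set.Icc 0 T :=
  ⟨le_max_left _ _, max_le hT (min_le_right _ _)⟩

lemma timeClamp_of_mem {T t : ℝ} (ht : t ∈ Set.Icc 0 T) : timeClamp T t = t := by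
  rw [timeClamp, min_eq_left ht.2, max_eq_right ht.1]

/-- The disjoint union of the space-times of all particle numbers. -/
abbrev SpaceTimes (d : ℕ) := Σ s : ℕ, ℝ × Phase d s

section Picard

open scoped BoundedContinuousFunction

variable {d : ℕ} {ℓ b m T : ℝ} {f₀ : (s : ℕ) → Phase d s → ℝ}

/-- The hierarchy obtained by multiplying a bounded function by the time dependent weight. -/
def weightedHierarchy (b m T : ℝ) (U : SpaceTimes d →ᵇ ℝ) (s : ℕ) (t : ℝ) (Z : Phase d s) : ℝ :=
  U ⟨s, t, Z⟩ * exp (-timeWeight b m T s (timeClamp T t) Z)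

lemma abs_weightedHierarchy_le (U : SpaceTimes d →ᵇ ℝ) (s : ℕ) (t : ℝ) (Z : Phase d s) :
    |weightedHierarchy b m T U s t Z| ≤ ‖U‖ * exp (-timeWeight b m T s (timeClamp T t) Z) := by
  rw [weightedHierarchy, abs_mul, abs_of_pos (exp_pos _)]
  exact mul_le_mul_of_nonneg_right (U.norm_coe_le_norm _) (exp_pos _).le

lemma mul_exp_neg_timeWeight_le {s : ℕ} {M t : ℝ} (hT : 0 < T) (hb : 0 ≤ b) (hM : 0 ≤ M)
    (ht : t ≤ T) (Z : Phase d s) : M * exp (-timeWeight b m T s t Z) ≤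
      M * exp (-((m - 1) * s)) * exp (-(b / 2) * shiftedWeight 0 Z) := by
  rw [mul_assoc, ← exp_add]
  have h := le_timeWeight (m := m) hT hb ht Z
  gcongr
  linarith

lemma continuous_weightedHierarchy (U : SpaceTimes d →ᵇ ℝ) (s : ℕ) :
    Continuous (Function.uncurry (weightedHierarchy b m T U s)) :=
  (U.continuous.comp continuous_sigmaMk).mul
    ((continuous_timeClamp.comp continuous_fst).timeWeight continuous_snd).neg.rexp

lemma weightedHierarchy_sub (U V : SpaceTimes d →ᵇ ℝ) (s : ℕ) (t : ℝ) (Z : Phase d s) :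
    weightedHierarchy b m T (U - V) s t Z =
      weightedHierarchy b m T U s t Z - weightedHierarchy b m T V s t Z := by
  simp [weightedHierarchy, sub_mul]

/-- The right hand side of the mild form of the hierarchy. -/
def duhamelMap (ℓ T : ℝ) (f₀ : (s : ℕ) → Phase d s → ℝ) (F : (s : ℕ) → ℝ → Phase d s → ℝ)
    (s : ℕ) (t : ℝ) (Z : Phase d s) : ℝ :=
  f₀ s Z + ℓ⁻¹ * ∫ τ in (0 : ℝ)..timeClamp T t, interactionCollision τ (F (s + 1) τ) Z

lemma continuous_interactionCollision_weightedHierarchy (hT : 0 < T) (hb : 0 < b)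
    (U : SpaceTimes d →ᵇ ℝ) (s : ℕ) :
    Continuous fun p : ℝ × Phase d s =>
      interactionCollision p.1 (weightedHierarchy b m T U (s + 1) p.1) p.2 :=
  continuous_interactionCollision (half_pos hb) (by positivity) (continuous_weightedHierarchy U _)
    fun τ Z => (abs_weightedHierarchy_le U _ τ Z).trans
      (mul_exp_neg_timeWeight_le hT hb.le (norm_nonneg _) (timeClamp_mem hT.le τ).2 Z)

lemma continuous_duhamelMap (hT : 0 < T) (hb : 0 < b) (hf₀ : ∀ s, Continuous (f₀ s))
    (U : SpaceTimes d →ᵇ ℝ) (s : ℕ) :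
    Continuous (Function.uncurry (duhamelMap ℓ T f₀ (weightedHierarchy b m T U) s)) := by
  have h := continuous_primitive (G := fun τ (Z : Phase d s) =>
    interactionCollision τ (weightedHierarchy b m T U (s + 1) τ) Z)
    (continuous_interactionCollision_weightedHierarchy hT hb U s)
  have h' : Continuous fun p : ℝ × Phase d s => (timeClamp T p.1, p.2) :=
    (continuous_timeClamp.comp continuous_fst).prodMk continuous_snd
  have h2 := h.comp h'
  simp only [Function.comp_def] at h2
  exact ((hf₀ s).comp continuous_snd).add (continuous_const.mul h2)

lemma abs_duhamelMap_le (hℓ : 0 < ℓ) (hT : 0 < T) (hb : 0 < b)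
    (hsmall : 3 * collConst d * exp (1 - m) * T ≤ ℓ * √(b / 2) ^ (d + 1))
    (hf₀ : ∀ s Z, |f₀ s Z| ≤ exp (-(b * shiftedWeight 0 Z + m * s)))
    (U : SpaceTimes d →ᵇ ℝ) (s : ℕ) (t : ℝ) (Z : Phase d s) :
    |duhamelMap ℓ T f₀ (weightedHierarchy b m T U) s t Z| ≤
      (1 + ‖U‖ / 2) * exp (-timeWeight b m T s (timeClamp T t) Z) := by
  have ht := timeClamp_mem hT.le t
  have h1 := abs_duhamel_le (H := weightedHierarchy b m T U (s + 1)) hℓ hT hb (norm_nonneg U) hsmall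
    (fun τ hτ Z => by
      have := abs_weightedHierarchy_le (b := b) (m := m) (T := T) U (s + 1) τ Z
      rwa [timeClamp_of_mem hτ] at this) ht Z
  have h2 : exp (-(b * shiftedWeight 0 Z + m * s)) ≤
      exp (-timeWeight b m T s (timeClamp T t) Z) :=
    exp_le_exp.mpr (neg_le_neg (timeWeight_le hT hb.le ht.1 Z))
  rw [add_mul, one_mul]
  exact (abs_add_le _ _).trans (add_le_add ((hf₀ s Z).trans h2) h1)

lemma abs_duhamelMap_sub_le (hℓ : 0 < ℓ) (hT : 0 < T) (hb : 0 < b)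
    (hsmall : 3 * collConst d * exp (1 - m) * T ≤ ℓ * √(b / 2) ^ (d + 1))
    (U V : SpaceTimes d →ᵇ ℝ) (s : ℕ) (t : ℝ) (Z : Phase d s) :
    |duhamelMap ℓ T f₀ (weightedHierarchy b m T U) s t Z -
      duhamelMap ℓ T f₀ (weightedHierarchy b m T V) s t Z| ≤
      ‖U - V‖ / 2 * exp (-timeWeight b m T s (timeClamp T t) Z) := by
  have ht := timeClamp_mem hT.le t
  have h1 := abs_duhamel_le (H := weightedHierarchy b m T (U - V) (s + 1)) hℓ hT hb
    (norm_nonneg (U - V)) hsmall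
    (fun τ hτ Z => by
      have := abs_weightedHierarchy_le (b := b) (m := m) (T := T) (U - V) (s + 1) τ Z
      rwa [timeClamp_of_mem hτ] at this) ht Z
  have hbound : ∀ (W : SpaceTimes d →ᵇ ℝ) (τ : ℝ) (Z : Phase d (s + 1)),
      |weightedHierarchy b m T W (s + 1) τ Z| ≤
        ‖W‖ * exp (-((m - 1) * (s + 1 : ℕ))) * exp (-(b / 2) * shiftedWeight 0 Z) := fun W τ Z =>
    (abs_weightedHierarchy_le W _ τ Z).trans
      (mul_exp_neg_timeWeight_le hT hb.le (norm_nonneg _) (timeClamp_mem hT.le τ).2 Z)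
  have hcont : ∀ (W : SpaceTimes d →ᵇ ℝ) (τ : ℝ), Continuous (weightedHierarchy b m T W (s + 1) τ) :=
    fun W τ => (continuous_weightedHierarchy W (s + 1)).comp (continuous_const.prodMk continuous_id)
  have h2 : ∀ τ, interactionCollision τ (weightedHierarchy b m T (U - V) (s + 1) τ) Z =
      interactionCollision τ (weightedHierarchy b m T U (s + 1) τ) Z -
      interactionCollision τ (weightedHierarchy b m T V (s + 1) τ) Z := by
    intro τ
    rw [← interactionCollision_sub (half_pos hb) (by positivity) (by positivity) (hcont U τ)
      (hcont V τ) (hbound U τ) (hbound V τ)]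
    simp only [← weightedHierarchy_sub]
  have hint : ∀ W : SpaceTimes d →ᵇ ℝ, Continuous fun τ =>
      interactionCollision τ (weightedHierarchy b m T W (s + 1) τ) Z := by
    intro W
    have h := (continuous_interactionCollision_weightedHierarchy (m := m) hT hb W s).comp
      (continuous_id.prodMk (continuous_const (y := Z)))
    simpa only [Function.comp_def, id] using h
  simp only [h2] at h1
  rw [intervalIntegral.integral_sub ((hint U).intervalIntegrable _ _)
    ((hint V).intervalIntegrable _ _), mul_sub] at h1
  rw [duhamelMap, duhamelMap, add_sub_add_left_eq_sub]
  exact h1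

/-- The Picard map of the hierarchy in the weighted unknown. -/
def picardMap (hℓ : 0 < ℓ) (hT : 0 < T) (hb : 0 < b)
    (hsmall : 3 * collConst d * exp (1 - m) * T ≤ ℓ * √(b / 2) ^ (d + 1))
    (hf₀c : ∀ s, Continuous (f₀ s))
    (hf₀ : ∀ s Z, |f₀ s Z| ≤ exp (-(b * shiftedWeight 0 Z + m * s)))
    (U : SpaceTimes d →ᵇ ℝ) : SpaceTimes d →ᵇ ℝ :=
  BoundedContinuousFunction.ofNormedAddCommGroup
    (fun p => exp (timeWeight b m T p.1 (timeClamp T p.2.1) p.2.2) *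
      duhamelMap ℓ T f₀ (weightedHierarchy b m T U) p.1 p.2.1 p.2.2)
    (continuous_sigma fun s =>
      ((continuous_timeClamp.comp continuous_fst).timeWeight continuous_snd).rexp.mul
        (continuous_duhamelMap hT hb hf₀c U s))
    (1 + ‖U‖ / 2)
    (fun p => by
      rw [Real.norm_eq_abs, abs_mul, abs_of_pos (exp_pos _)]
      refine (mul_le_mul_of_nonneg_left (abs_duhamelMap_le hℓ hT hb hsmall hf₀ U _ _ _)
        (exp_pos _).le).trans_eq ?_
      rw [mul_left_comm, ← exp_add, add_neg_cancel, exp_zero, mul_one])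

lemma weightedHierarchy_picardMap (hℓ : 0 < ℓ) (hT : 0 < T) (hb : 0 < b)
    (hsmall : 3 * collConst d * exp (1 - m) * T ≤ ℓ * √(b / 2) ^ (d + 1))
    (hf₀c : ∀ s, Continuous (f₀ s))
    (hf₀ : ∀ s Z, |f₀ s Z| ≤ exp (-(b * shiftedWeight 0 Z + m * s)))
    (U : SpaceTimes d →ᵇ ℝ) (s : ℕ) (t : ℝ) (Z : Phase d s) :
    weightedHierarchy b m T (picardMap hℓ hT hb hsmall hf₀c hf₀ U) s t Z =
      duhamelMap ℓ T f₀ (weightedHierarchy b m T U) s t Z := by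
  rw [weightedHierarchy, picardMap, BoundedContinuousFunction.coe_ofNormedAddCommGroup,
    mul_right_comm, ← exp_add, add_neg_cancel, exp_zero, one_mul]

lemma contractingWith_picardMap (hℓ : 0 < ℓ) (hT : 0 < T) (hb : 0 < b)
    (hsmall : 3 * collConst d * exp (1 - m) * T ≤ ℓ * √(b / 2) ^ (d + 1))
    (hf₀c : ∀ s, Continuous (f₀ s))
    (hf₀ : ∀ s Z, |f₀ s Z| ≤ exp (-(b * shiftedWeight 0 Z + m * s))) :
    ContractingWith (1 / 2) (picardMap hℓ hT hb hsmall hf₀c hf₀) := by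
  refine ⟨by rw [← NNReal.coe_lt_coe]; norm_num, LipschitzWith.of_dist_le_mul fun U V => ?_⟩
  rw [dist_eq_norm, dist_eq_norm]
  refine (BoundedContinuousFunction.norm_le (by positivity)).mpr fun p => ?_
  rw [BoundedContinuousFunction.sub_apply, picardMap, picardMap,
    BoundedContinuousFunction.coe_ofNormedAddCommGroup,
    BoundedContinuousFunction.coe_ofNormedAddCommGroup, ← mul_sub, Real.norm_eq_abs, abs_mul,
    abs_of_pos (exp_pos _)]
  refine (mul_le_mul_of_nonneg_left (abs_duhamelMap_sub_le hℓ hT hb hsmall U V _ _ _)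
    (exp_pos _).le).trans_eq ?_
  rw [mul_left_comm, ← exp_add, add_neg_cancel, exp_zero, mul_one]
  push_cast
  ring

lemma exists_mild_solution (hℓ : 0 < ℓ) (hT : 0 < T) (hb : 0 < b)
    (hsmall : 3 * collConst d * exp (1 - m) * T ≤ ℓ * √(b / 2) ^ (d + 1))
    (hf₀c : ∀ s, Continuous (f₀ s))
    (hf₀symm : ∀ s (σ : Equiv.Perm (Fin s)) Z, f₀ s (Z ∘ σ) = f₀ s Z)
    (hf₀ : ∀ s Z, |f₀ s Z| ≤ exp (-(b * shiftedWeight 0 Z + m * s))) :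
    ∃ F : (s : ℕ) → ℝ → Phase d s → ℝ, (∀ s, Continuous (Function.uncurry (F s))) ∧
      (∀ s (σ : Equiv.Perm (Fin s)) t Z, F s t (Z ∘ σ) = F s t Z) ∧
      (∀ s t Z, |F s t Z| ≤ 2 * exp (-timeWeight b m T s (timeClamp T t) Z)) ∧
      (∀ s, ∀ t ∈ Set.Icc 0 T, ∀ Z, F s t Z =
        f₀ s Z + ℓ⁻¹ * ∫ τ in (0 : ℝ)..t, interactionCollision τ (F (s + 1) τ) Z) := by
  set Φ := picardMap hℓ hT hb hsmall hf₀c hf₀ with hΦdef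
  have hΦ : ContractingWith (1 / 2) Φ := contractingWith_picardMap hℓ hT hb hsmall hf₀c hf₀
  set U := ContractingWith.fixedPoint Φ hΦ with hU
  have hfix : Φ U = U := hΦ.fixedPoint_isFixedPt
  have hnorm : ‖U‖ ≤ 2 := by
    have h1 : ‖Φ U‖ ≤ 1 + ‖U‖ / 2 :=
      BoundedContinuousFunction.norm_ofNormedAddCommGroup_le _ (by positivity) _
    rw [hfix] at h1
    linarith
  have hstep : ∀ V : SpaceTimes d →ᵇ ℝ,
      (∀ s (σ : Equiv.Perm (Fin s)) t (Z : Phase d s), V ⟨s, t, Z ∘ σ⟩ = V ⟨s, t, Z⟩) →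
      ∀ s (σ : Equiv.Perm (Fin s)) t (Z : Phase d s), Φ V ⟨s, t, Z ∘ σ⟩ = Φ V ⟨s, t, Z⟩ := by
    intro V hV s σ t Z
    have h1 : ∀ τ, interactionCollision τ (weightedHierarchy b m T V (s + 1) τ) (Z ∘ σ) =
        interactionCollision τ (weightedHierarchy b m T V (s + 1) τ) Z := fun τ =>
      interactionCollision_comp_perm (fun σ' Z' => by
        rw [weightedHierarchy, weightedHierarchy, hV, timeWeight_comp_perm]) τ σ Z
    simp only [hΦdef, picardMap, BoundedContinuousFunction.coe_ofNormedAddCommGroup, duhamelMap, h1,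
      timeWeight_comp_perm, hf₀symm]
  have hiter : ∀ n s (σ : Equiv.Perm (Fin s)) t (Z : Phase d s),
      (Φ^[n] 0) ⟨s, t, Z ∘ σ⟩ = (Φ^[n] 0) ⟨s, t, Z⟩ := by
    intro n
    induction n with
    | zero => intro s σ t Z; rfl
    | succ n ih =>
      rw [Function.iterate_succ_apply']
      exact hstep _ ih
  have hsymm : ∀ s (σ : Equiv.Perm (Fin s)) t (Z : Phase d s), U ⟨s, t, Z ∘ σ⟩ = U ⟨s, t, Z⟩ := by
    intro s σ t Z
    have hlim : ∀ p, Filter.Tendsto (fun n => (Φ^[n] 0) p) Filter.atTop (nhds (U p)) := fun p =>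
      ((continuous_eval_const (F := SpaceTimes d →ᵇ ℝ) p).tendsto U).comp
        (hΦ.tendsto_iterate_fixedPoint 0)
    refine tendsto_nhds_unique (hlim _) ?_
    simpa only [hiter] using hlim ⟨s, t, Z⟩
  refine ⟨weightedHierarchy b m T U, continuous_weightedHierarchy U, ?_, ?_, ?_⟩
  · intro s σ t Z
    rw [weightedHierarchy, weightedHierarchy, hsymm, timeWeight_comp_perm]
  · intro s t Z
    exact (abs_weightedHierarchy_le U s t Z).trans
      (mul_le_mul_of_nonneg_right hnorm (exp_pos _).le)
  · intro s t ht Z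
    have h1 := weightedHierarchy_picardMap hℓ hT hb hsmall hf₀c hf₀ U s t Z
    rw [← hΦdef, hfix, duhamelMap, timeClamp_of_mem ht] at h1
    exact h1

end Picard

/-! ### Well-posedness -/

lemma abs_le_of_mul_exp_le {a M x y : ℝ} (h : |a| * exp x * exp y ≤ M) :
    |a| ≤ M * exp (-(x + y)) := by
  rw [mul_assoc, ← exp_add] at h
  rw [exp_neg, ← div_eq_mul_inv]
  exact (le_div_iff₀ (exp_pos _)).mpr h

lemma eq_of_mild {d : ℕ} {ℓ T b m M : ℝ} (hℓ : 0 < ℓ) (hT : 0 < T) (hb : 0 < b) (hM : 0 ≤ M)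
    (hsmall : 3 * collConst d * exp (1 - m) * T ≤ ℓ * √(b / 2) ^ (d + 1))
    {f₀ : (s : ℕ) → Phase d s → ℝ} {F G : (s : ℕ) → ℝ → Phase d s → ℝ}
    (hFc : ∀ s, Continuous (Function.uncurry (F s)))
    (hGc : ∀ s, Continuous (Function.uncurry (G s)))
    (hF : ∀ s, 1 ≤ s → ∀ t Z, |F s t Z| ≤ M * exp (-(b * shiftedWeight 0 Z + m * s)))
    (hG : ∀ s, 1 ≤ s → ∀ t Z, |G s t Z| ≤ M * exp (-(b * shiftedWeight 0 Z + m * s)))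
    (hFm : ∀ s, 1 ≤ s → ∀ t ∈ Set.Icc 0 T, ∀ Z, F s t Z =
      f₀ s Z + ℓ⁻¹ * ∫ τ in (0 : ℝ)..t, interactionCollision τ (F (s + 1) τ) Z)
    (hGm : ∀ s, 1 ≤ s → ∀ t ∈ Set.Icc 0 T, ∀ Z, G s t Z =
      f₀ s Z + ℓ⁻¹ * ∫ τ in (0 : ℝ)..t, interactionCollision τ (G (s + 1) τ) Z)
    {s : ℕ} (hs : 1 ≤ s) {t : ℝ} (ht : t ∈ Set.Icc 0 T) (Z : Phase d s) : F s t Z = G s t Z := by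
  have hsplit : ∀ {H : (s : ℕ) → ℝ → Phase d s → ℝ},
      (∀ s, 1 ≤ s → ∀ t Z, |H s t Z| ≤ M * exp (-(b * shiftedWeight 0 Z + m * s))) →
      ∀ s, 1 ≤ s → ∀ t Z, |H s t Z| ≤ M * exp (-(m * s)) * exp (-b * shiftedWeight 0 Z) := by
    intro H hH s hs t Z
    refine (hH s hs t Z).trans_eq ?_
    rw [mul_assoc, ← exp_add]
    congr 2
    ring
  have hcoll : ∀ {H : (s : ℕ) → ℝ → Phase d s → ℝ}, (∀ s, Continuous (Function.uncurry (H s))) →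
      (∀ s, 1 ≤ s → ∀ t Z, |H s t Z| ≤ M * exp (-(b * shiftedWeight 0 Z + m * s))) →
      ∀ (s : ℕ) (Z : Phase d s), Continuous fun τ => interactionCollision τ (H (s + 1) τ) Z := by
    intro H hHc hH s Z
    have h := (continuous_interactionCollision hb (by positivity) (hHc (s + 1))
      (hsplit hH (s + 1) (by omega))).comp (continuous_id.prodMk (continuous_const (y := Z)))
    simpa only [Function.comp_def, id] using h
  have hcont : ∀ {H : (s : ℕ) → ℝ → Phase d s → ℝ}, (∀ s, Continuous (Function.uncurry (H s))) →
      ∀ s τ, Continuous (H s τ) := fun hHc s τ =>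
    (hHc s).comp (continuous_const.prodMk continuous_id)
  have key : ∀ n : ℕ, ∀ s, 1 ≤ s → ∀ t ∈ Set.Icc 0 T, ∀ Z, |F s t Z - G s t Z| ≤
      2 * M * (1 / 2) ^ n * exp (-timeWeight b m T s t Z) := by
    intro n
    induction n with
    | zero =>
      intro s hs t ht Z
      have h1 : exp (-(b * shiftedWeight 0 Z + m * s)) ≤ exp (-timeWeight b m T s t Z) :=
        exp_le_exp.mpr (neg_le_neg (timeWeight_le hT hb.le ht.1 Z))
      have h2 := (abs_sub _ _).trans (add_le_add (hF s hs t Z) (hG s hs t Z))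
      have h3 := mul_le_mul_of_nonneg_left h1 hM
      rw [pow_zero]
      linarith
    | succ n ih =>
      intro s hs t ht Z
      have h1 := abs_duhamel_le (H := fun τ Z => F (s + 1) τ Z - G (s + 1) τ Z)
        (M := 2 * M * (1 / 2) ^ n) hℓ hT hb (by positivity) hsmall
        (fun τ hτ Z => ih (s + 1) (by omega) τ hτ Z) ht Z
      have h2 : ∀ τ, interactionCollision τ (fun Z => F (s + 1) τ Z - G (s + 1) τ Z) Z =
          interactionCollision τ (F (s + 1) τ) Z - interactionCollision τ (G (s + 1) τ) Z :=
        fun τ => interactionCollision_sub hb (by positivity) (by positivity) (hcont hFc _ τ)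
          (hcont hGc _ τ) (hsplit hF (s + 1) (by omega) τ) (hsplit hG (s + 1) (by omega) τ) τ Z
      simp only [h2] at h1
      rw [intervalIntegral.integral_sub ((hcoll hFc hF s Z).intervalIntegrable _ _)
        ((hcoll hGc hG s Z).intervalIntegrable _ _), mul_sub] at h1
      rw [hFm s hs t ht, hGm s hs t ht, add_sub_add_left_eq_sub]
      refine h1.trans_eq ?_
      ring
  have hlim : Filter.Tendsto (fun n : ℕ => 2 * M * (1 / 2) ^ n * exp (-timeWeight b m T s t Z))
      Filter.atTop (nhds 0) := by
    have h := ((tendsto_pow_atTop_nhds_zero_of_lt_one (r := (1 / 2 : ℝ)) (by norm_num)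
      (by norm_num)).const_mul (2 * M)).mul_const (exp (-timeWeight b m T s t Z))
    simpa only [mul_zero, zero_mul] using h
  have h0 := ge_of_tendsto' hlim fun n => key n s hs t ht Z
  exact sub_eq_zero.mp (abs_nonpos_iff.mp h0)

/-- A time dependent family on `[0, T]` read along free transport, extended constantly in time. -/
def interactionPicture {d : ℕ} (T : ℝ) (g : (s : ℕ) → ℝ → Phase d s → ℝ) (s : ℕ) (t : ℝ)
    (Z : Phase d s) : ℝ :=
  g s (timeClamp T t) (freeFlow (timeClamp T t) Z)

section GoodLocalSol

variable {d : ℕ} {ℓ T β₀ μ₀ : ℝ} {f₀ : (s : ℕ) → Phase d s → ℝ} {g : (s : ℕ) → ℝ → Phase d s → ℝ}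

lemma interactionPicture_freeFlow_neg {t : ℝ} (ht : t ∈ Set.Icc 0 T) (s : ℕ) (Z : Phase d s) :
    interactionPicture T g s t (freeFlow (-t) Z) = g s t Z := by
  rw [interactionPicture, timeClamp_of_mem ht, freeFlow_freeFlow_neg]

lemma GoodLocalSol.continuous_interactionPicture (hT : 0 < T) (hg : GoodLocalSol d ℓ T β₀ μ₀ f₀ g)
    (s : ℕ) : Continuous (Function.uncurry (interactionPicture T g s)) := by
  have hc : Continuous fun p : ℝ × Phase d s => timeClamp T p.1 :=
    continuous_timeClamp.comp continuous_fst
  have h := (hg.1 s).comp_continuous (hc.prodMk (hc.freeFlow continuous_snd))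
    fun p => ⟨timeClamp_mem hT.le p.1, Set.mem_univ _⟩
  exact h

lemma GoodLocalSol.abs_interactionPicture_le (hT : 0 < T) (hg : GoodLocalSol d ℓ T β₀ μ₀ f₀ g)
    (s : ℕ) (hs : 1 ≤ s) (t : ℝ) (Z : Phase d s) :
    |interactionPicture T g s t Z| ≤
      2 * exp (-(β₀ / 2 * shiftedWeight 0 Z + (μ₀ - 1) * s)) := by
  have h := abs_le_of_mul_exp_le (hg.2.2.2.1 _ (timeClamp_mem hT.le t) s hs
    (freeFlow (timeClamp T t) Z))
  have h2 := shiftedWeight_freeFlow (timeClamp T t) Z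
  rw [shiftedWeight] at h2
  rw [h2] at h
  refine h.trans_eq ?_
  congr 3
  ring

lemma GoodLocalSol.mild (hT : 0 < T) (hβ : 0 < β₀)
    (hg : GoodLocalSol d ℓ T β₀ μ₀ f₀ g) (s : ℕ) (hs : 1 ≤ s) (t : ℝ) (ht : t ∈ Set.Icc 0 T)
    (Z : Phase d s) : interactionPicture T g s t Z = f₀ s Z +
      ℓ⁻¹ * ∫ τ in (0 : ℝ)..t, interactionCollision τ (interactionPicture T g (s + 1) τ) Z := by
  have hcoll : Continuous fun p : ℝ × Phase d s =>
      interactionCollision p.1 (interactionPicture T g (s + 1) p.1) p.2 :=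
    continuous_interactionCollision (half_pos hβ) (M := 2 * exp (-((μ₀ - 1) * (s + 1 : ℕ))))
      (by positivity) (hg.continuous_interactionPicture hT (s + 1)) fun τ Z' => by
        refine (hg.abs_interactionPicture_le hT (s + 1) (by omega) τ Z').trans_eq ?_
        rw [mul_assoc, ← exp_add]
        congr 2
        ring
  have h0 : interactionPicture T g s 0 Z = f₀ s Z := by
    rw [interactionPicture, timeClamp_of_mem ⟨le_rfl, hT.le⟩, freeFlow_zero, hg.2.2.1]
  rw [← intervalIntegral.integral_const_mul, ← h0]
  refine mild_of_weak hT (hg.continuous_interactionPicture hT s)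
    (G := fun τ Z => ℓ⁻¹ * interactionCollision τ (interactionPicture T g (s + 1) τ) Z)
    (continuous_const.mul hcoll) (fun φ hφ hφc hφ0 => ?_) ht Z
  refine Eq.trans (setIntegral_congr_fun measurableSet_Ioo fun t ht => ?_)
    (hg.2.2.2.2 s hs φ hφ hφc hφ0)
  have ht' : t ∈ Set.Icc 0 T := ⟨ht.1.le, ht.2.le⟩
  simp only [interactionCollision, interactionPicture_freeFlow_neg ht', freeFlow_freeFlow_neg]
  refine integral_congr_ae (Filter.Eventually.of_forall fun Z => ?_)
  simp only
  ring

lemma GoodLocalSol.unique (hℓ : 0 < ℓ) (hT : 0 < T) (hβ : 0 < β₀)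
    (hsmall : 3 * collConst d * exp (1 - (μ₀ - 1)) * T ≤ ℓ * √(β₀ / 2 / 2) ^ (d + 1))
    {f : (s : ℕ) → ℝ → Phase d s → ℝ} (hf : GoodLocalSol d ℓ T β₀ μ₀ f₀ f)
    (hg : GoodLocalSol d ℓ T β₀ μ₀ f₀ g) (s : ℕ) (hs : 1 ≤ s) (t : ℝ) (ht : t ∈ Set.Icc 0 T)
    (Z : Phase d s) : g s t Z = f s t Z := by
  rw [← interactionPicture_freeFlow_neg (g := g) ht, ← interactionPicture_freeFlow_neg (g := f) ht]
  exact eq_of_mild hℓ hT (half_pos hβ) zero_le_two hsmall (hg.continuous_interactionPicture hT)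
    (hf.continuous_interactionPicture hT) (hg.abs_interactionPicture_le hT)
    (hf.abs_interactionPicture_le hT) (hg.mild hT hβ) (hf.mild hT hβ) hs ht _

lemma exists_goodLocalSol (hℓ : 0 < ℓ) (hT : 0 < T) (hβ : 0 < β₀)
    (hsmall : 3 * collConst d * exp (1 - μ₀) * T ≤ ℓ * √(β₀ / 2) ^ (d + 1))
    (hf₀c : ∀ s, Continuous (f₀ s))
    (hf₀symm : ∀ s (σ : Equiv.Perm (Fin s)) Z, f₀ s (Z ∘ σ) = f₀ s Z)
    (hf₀ : ∀ s, 1 ≤ s → ∀ Z, |f₀ s Z| ≤ exp (-(β₀ * shiftedWeight 0 Z + μ₀ * s))) :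
    ∃ f, GoodLocalSol d ℓ T β₀ μ₀ f₀ f := by
  set f₀' : (s : ℕ) → Phase d s → ℝ := fun s Z => if s = 0 then 0 else f₀ s Z with hf₀'
  obtain ⟨F, hFc, hFsymm, hF, hFm⟩ := exists_mild_solution (f₀ := f₀') hℓ hT hβ hsmall
    (fun s => by
      by_cases hs : s = 0
      · simpa only [hf₀', hs, if_true] using continuous_const
      · simpa only [hf₀', hs, if_false] using hf₀c s)
    (fun s σ Z => by simp only [hf₀', hf₀symm])
    (fun s Z => by
      by_cases hs : s = 0
      · simp only [hf₀', if_pos hs, abs_zero]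
        positivity
      · simp only [hf₀', if_neg hs]
        exact hf₀ s (Nat.one_le_iff_ne_zero.mpr hs) Z)
  have hF0 : ∀ s Z, F s 0 Z = f₀' s Z := fun s Z => by
    rw [hFm s 0 ⟨le_rfl, hT.le⟩ Z, intervalIntegral.integral_same, mul_zero, add_zero]
  have hcoll : ∀ s, Continuous fun p : ℝ × Phase d s =>
      interactionCollision p.1 (F (s + 1) p.1) p.2 := fun s =>
    continuous_interactionCollision (half_pos hβ) (by positivity) (hFc (s + 1)) fun τ Z =>
      (hF (s + 1) τ Z).trans
        (mul_exp_neg_timeWeight_le hT hβ.le zero_le_two (timeClamp_mem hT.le τ).2 Z)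
  refine ⟨fun s t Z => if s = 0 then f₀ s Z else F s t (freeFlow (-t) Z), ?_, ?_, ?_, ?_, ?_⟩
  · intro s
    refine Continuous.continuousOn ?_
    by_cases hs : s = 0
    · subst hs
      exact (hf₀c 0).comp continuous_snd
    · simp only [hs, if_false]
      exact (hFc s).comp (continuous_fst.prodMk (continuous_fst.neg.freeFlow continuous_snd))
  · intro s σ t Z
    simp only [freeFlow_comp_perm, hFsymm, hf₀symm]
  · intro s Z
    by_cases hs : s = 0
    · simp only [if_pos hs]
    · simp only [if_neg hs, neg_zero, freeFlow_zero, hF0, hf₀']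
  · intro t ht s hs Z
    simp only [if_neg (Nat.one_le_iff_ne_zero.mp hs)]
    have h1 := hF s t (freeFlow (-t) Z)
    have h2 := le_timeWeight (m := μ₀) hT hβ.le ht.2 (freeFlow (-t) Z)
    rw [shiftedWeight_zero_freeFlow_neg, shiftedWeight] at h2
    rw [timeClamp_of_mem ht] at h1
    rw [mul_assoc, ← exp_add]
    refine (mul_le_mul_of_nonneg_right h1 (exp_pos _).le).trans ?_
    rw [mul_assoc, ← exp_add]
    have h3 : exp (-timeWeight β₀ μ₀ T s t (freeFlow (-t) Z) +
        (1 / 2 * β₀ * (energy Z + inertiaShift t Z) + (μ₀ - 1) * s)) ≤ 1 :=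
      exp_le_one_iff.mpr (by linarith)
    linarith
  · intro s hs φ hφ hφc hφ0
    simp only [if_neg (Nat.one_le_iff_ne_zero.mp hs), if_neg (Nat.succ_ne_zero s)]
    have h := weak_of_mild hT (F := F s)
      (G := fun τ Z => ℓ⁻¹ * interactionCollision τ (F (s + 1) τ) Z)
      ((hFc s).comp (continuous_const.prodMk continuous_id)) (continuous_const.mul (hcoll s))
      (fun t ht Z => by rw [hFm s t ht Z, hF0, intervalIntegral.integral_const_mul]) hφ hφc hφ0
    simp only [interactionCollision, freeFlow_freeFlow_neg] at h
    refine Eq.trans (setIntegral_congr_fun measurableSet_Ioo fun t _ => ?_) h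
    refine integral_congr_ae (Filter.Eventually.of_forall fun Z => ?_)
    simp only
    ring

end GoodLocalSol

lemma smallness_of_lt {d : ℕ} {ℓ T β μ : ℝ} (hβ : 0 < β) (hT : 0 < T)
    (h : T < (3 * collConst d + 1)⁻¹ * (exp 2)⁻¹ * (2 ^ (d + 1))⁻¹ * ℓ * exp μ *
      β ^ (((d : ℝ) + 1) / 2)) :
    3 * collConst d * exp (1 - (μ - 1)) * T ≤ ℓ * √(β / 2 / 2) ^ (d + 1) := by
  have hA := collConst_nonneg d
  have h1 : β ^ (((d : ℝ) + 1) / 2) = √β ^ (d + 1) := by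
    rw [sqrt_eq_rpow, ← rpow_natCast, ← rpow_mul hβ.le]
    congr 1
    push_cast
    ring
  have h2 : √(β / 2 / 2) = √β / 2 := by
    rw [show β / 2 / 2 = β / 2 ^ 2 by ring, sqrt_div hβ.le, sqrt_sq zero_le_two]
  have h3 : exp (1 - (μ - 1)) = exp 2 * (exp μ)⁻¹ := by
    rw [← exp_neg, ← exp_add]
    congr 1
    ring
  rw [h1] at h
  have h4 : (3 * collConst d + 1) * exp 2 * (exp μ)⁻¹ * T ≤ ℓ * (√β ^ (d + 1) / 2 ^ (d + 1)) := by
    refine (mul_le_mul_of_nonneg_left h.le (by positivity)).trans_eq ?_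
    have := (exp_pos μ).ne'
    have := (exp_pos 2).ne'
    have : 3 * collConst d + 1 ≠ 0 := by positivity
    field_simp
  rw [h2, h3, div_pow]
  refine le_trans ?_ h4
  have : 0 ≤ exp 2 * (exp μ)⁻¹ * T := by positivity
  linarith

lemma smallness_mono {d : ℕ} {ℓ T β μ : ℝ} (hℓ : 0 < ℓ) (hβ : 0 < β) (hT : 0 < T)
    (h : 3 * collConst d * exp (1 - (μ - 1)) * T ≤ ℓ * √(β / 2 / 2) ^ (d + 1)) :
    3 * collConst d * exp (1 - μ) * T ≤ ℓ * √(β / 2) ^ (d + 1) := by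
  have hA := collConst_nonneg d
  refine le_trans ?_ (h.trans ?_)
  · gcongr
    linarith
  · gcongr
    linarith

/-- **Local well-posedness of the Boltzmann hierarchy with Gaussian position–velocity
weights (Theorem 11.2).** There is `C_d > 0`, depending only on `d`, such that: for
continuous symmetric data with `|f_∞^{(s)}(0)| e^{β₀[E_s+I_s]} e^{μ₀ s} ≤ 1` and any
`T_L < C_d ℓ e^{μ₀} β₀^{(d+1)/2}`, there is a unique continuous symmetric solution of
the Boltzmann hierarchy on `[0,T_L]` attaining the data and satisfying
`|f_∞^{(s)}(t)| e^{(1/2)β₀[E_s + I_s((X−Vt,V))]} e^{(μ₀−1)s} ≤ 2`. -/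
theorem boltzmann_hierarchy_local_wellposedness_weighted
    (d : ℕ) (hd : 2 ≤ d) :
    ∃ C : ℝ, 0 < C ∧
      ∀ (ℓ β₀ μ₀ : ℝ) (f₀ : (s : ℕ) → Phase d s → ℝ),
        0 < ℓ → 0 < β₀ →
        (∀ s : ℕ, Continuous (f₀ s)) →
        (∀ s : ℕ, ∀ σ : Equiv.Perm (Fin s), ∀ Z : Phase d s, f₀ s (Z ∘ σ) = f₀ s Z) →
        (∀ s : ℕ, 1 ≤ s → ∀ Z : Phase d s,
          |f₀ s Z| * exp (β₀ * (energy Z + inertia Z)) * exp (μ₀ * s) ≤ 1) →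
        ∀ T : ℝ, 0 < T → T < C * ℓ * exp μ₀ * β₀ ^ (((d : ℝ) + 1) / 2) →
        ∃ f : (s : ℕ) → ℝ → Phase d s → ℝ,
          GoodLocalSol d ℓ T β₀ μ₀ f₀ f ∧
          ∀ g : (s : ℕ) → ℝ → Phase d s → ℝ,
            GoodLocalSol d ℓ T β₀ μ₀ f₀ g →
            ∀ s : ℕ, 1 ≤ s → ∀ t ∈ Set.Icc (0 : ℝ) T, ∀ Z : Phase d s,
              g s t Z = f s t Z := by
  have hA := collConst_nonneg d
  refine ⟨(3 * collConst d + 1)⁻¹ * (exp 2)⁻¹ * (2 ^ (d + 1))⁻¹, by positivity, ?_⟩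
  intro ℓ β₀ μ₀ f₀ hℓ hβ hf₀c hf₀symm hf₀ T hT hsmall
  have hs := smallness_of_lt hβ hT hsmall
  obtain ⟨f, hf⟩ := exists_goodLocalSol hℓ hT hβ (smallness_mono hℓ hβ hT hs) hf₀c hf₀symm
    fun s hs Z => by
      rw [shiftedWeight_zero, ← one_mul (exp _)]
      exact abs_le_of_mul_exp_le (hf₀ s hs Z)
  exact ⟨f, hf, fun g hg => hf.unique hℓ hT hβ hs hg⟩
end
end

section
/- Monotonicity of partition functions (Lemma 12.1). Let d ≥ 2, ℓ > 0, N ∈ ℕ, and let ε > 0 satisfy the Boltzmann–Grad scaling N ε^{d−1} = ℓ^{−1}. Let f_0 be a probability density on ℝ^d × ℝ^d with M := ‖f_0‖_{L^∞_x L^1_v} < ∞. Then for every 1 ≤ s < N: 𝒵_{s+1} ≥ 𝒵_s ( 1 − ℓ^{−1} |B_1^d| M ε ), where |B_1^d| is the Lebesgue measure of the unit ball in ℝ^d. -/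
noncomputable section
open MeasureTheory
open scoped BigOperators

/-- The `s`-particle hard-sphere phase space `D_s`: all pairwise distances exceed `ε`. -/
def Dset (d s : ℕ) (ε : ℝ) : Set (Fin s → Rd d × Rd d) :=
  {Z | ∀ i j : Fin s, i < j → ε < dist (Z i).1 (Z j).1}

/-- The partition function `𝒵_s = ∫ 1_{Z_s ∈ D_s} ∏ f₀(z_i) dZ_s`. -/
def partitionFunction (d s : ℕ) (ε : ℝ) (f₀ : Rd d × Rd d → ℝ) : ℝ :=
  ∫ Z in Dset d s ε, ∏ i, f₀ (Z i)

/-- The volume of the unit ball in `ℝ^d`. -/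
def unitBallVol (d : ℕ) : ℝ := (volume (Metric.ball (0 : Rd d) 1)).toReal

/-- The conditioned tensorized `N`-particle density
`f_N(0,Z_N) = 𝒵_N⁻¹ 1_{Z_N ∈ D_N} ∏ f₀(z_i)`. -/
def conditionedData (d N : ℕ) (ε : ℝ) (f₀ : Rd d × Rd d → ℝ)
    (Z : Fin N → Rd d × Rd d) : ℝ :=
  (partitionFunction d N ε f₀)⁻¹ *
    Set.indicator (Dset d N ε) (fun W => ∏ i, f₀ (W i)) Z

/-- The `s`-particle marginal of an `N`-particle function. -/
def marginal (d N s : ℕ) (hsN : s ≤ N) (F : (Fin N → Rd d × Rd d) → ℝ)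
    (Z : Fin s → Rd d × Rd d) : ℝ :=
  ∫ W : Fin (N - s) → Rd d × Rd d,
    F (Fin.append Z W ∘ Fin.cast (Nat.add_sub_cancel' hsN).symm)

/-- The mass that `f` puts on positions within distance `ε` of `a` is at most `M |B_1^d| ε^d`. -/
lemma setIntegral_closedBall_prod_univ_le {d : ℕ} {ε M : ℝ} (hε : 0 < ε) {f : Rd d × Rd d → ℝ}
    (hint : Integrable f) (hM : ∀ᵐ x : Rd d, (∫ v : Rd d, f (x, v)) ≤ M) (a : Rd d) :
    ∫ z in Metric.closedBall a ε ×ˢ Set.univ, f z ≤ M * (ε ^ d * unitBallVol d) := by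
  have hvol : volume.real (Metric.closedBall a ε) = ε ^ d * unitBallVol d := by
    rw [measureReal_def, Measure.addHaar_closedBall _ _ hε.le, ENNReal.toReal_mul,
      ENNReal.toReal_ofReal (by positivity), finrank_euclideanSpace_fin, unitBallVol]
  have hprod : Integrable f ((volume : Measure (Rd d)).prod (volume : Measure (Rd d))) := hint
  rw [Measure.volume_eq_prod, setIntegral_prod _ hprod.integrableOn]
  simp only [Measure.restrict_univ]
  calc ∫ x in Metric.closedBall a ε, ∫ v, f (x, v)
      ≤ ∫ _ in Metric.closedBall a ε, M :=
        setIntegral_mono_ae hprod.integral_prod_left.integrableOn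
          (integrableOn_const measure_closedBall_lt_top.ne) hM
    _ = M * (ε ^ d * unitBallVol d) := by
        rw [setIntegral_const, hvol, smul_eq_mul, mul_comm]

/-- The positions at distance greater than `ε` from `s` given points carry at least the mass
`1 - s M |B_1^d| ε^d`. -/
lemma le_setIntegral_forall_lt_dist {d s : ℕ} {ε M : ℝ} (hε : 0 < ε) {f : Rd d × Rd d → ℝ}
    (hnn : ∀ z, 0 ≤ f z) (hint : Integrable f) (hmass : ∫ z, f z = 1)
    (hM : ∀ᵐ x : Rd d, (∫ v : Rd d, f (x, v)) ≤ M) (a : Fin s → Rd d) :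
    1 - s * (M * (ε ^ d * unitBallVol d)) ≤ ∫ z in {z | ∀ j, ε < dist z.1 (a j)}, f z := by
  have hA : MeasurableSet {z : Rd d × Rd d | ∀ j, ε < dist z.1 (a j)} := by
    simp only [Set.ofPred_forall]
    exact MeasurableSet.iInter fun j =>
      measurableSet_lt measurable_const (measurable_fst.dist measurable_const)
  have hB : ∀ j, MeasurableSet (Metric.closedBall (a j) ε ×ˢ (Set.univ : Set (Rd d))) :=
    fun j => Metric.isClosed_closedBall.measurableSet.prod MeasurableSet.univ
  have hBint : ∀ j ∈ (Finset.univ : Finset (Fin s)), Integrable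
      ((Metric.closedBall (a j) ε ×ˢ (Set.univ : Set (Rd d))).indicator f) :=
    fun j _ => hint.indicator (hB j)
  calc 1 - s * (M * (ε ^ d * unitBallVol d))
      = 1 - ∑ _j : Fin s, M * (ε ^ d * unitBallVol d) := by simp
    _ ≤ 1 - ∑ j : Fin s, ∫ z in Metric.closedBall (a j) ε ×ˢ Set.univ, f z := by
        gcongr with j
        exact setIntegral_closedBall_prod_univ_le hε hint hM (a j)
    _ = ∫ z, (f z - ∑ j, (Metric.closedBall (a j) ε ×ˢ (Set.univ : Set (Rd d))).indicator f z) := by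
        rw [integral_sub hint (integrable_finsetSum _ hBint), integral_finsetSum _ hBint, hmass]
        simp only [integral_indicator (hB _)]
    _ ≤ ∫ z, {z : Rd d × Rd d | ∀ j, ε < dist z.1 (a j)}.indicator f z := by
        refine integral_mono (hint.sub (integrable_finsetSum _ hBint)) (hint.indicator hA) ?_
        intro z
        have hterm : ∀ j ∈ (Finset.univ : Finset (Fin s)),
            0 ≤ (Metric.closedBall (a j) ε ×ˢ (Set.univ : Set (Rd d))).indicator f z :=
          fun j _ => Set.indicator_nonneg (fun z _ => hnn z) z
        by_cases hz : ∀ j, ε < dist z.1 (a j)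
        · rw [Set.indicator_of_mem (show z ∈ {z : Rd d × Rd d | ∀ j, ε < dist z.1 (a j)} from hz)]
          exact sub_le_self _ (Finset.sum_nonneg hterm)
        · rw [Set.indicator_of_notMem
            (show z ∉ {z : Rd d × Rd d | ∀ j, ε < dist z.1 (a j)} from hz)]
          push Not at hz
          obtain ⟨j, hj⟩ := hz
          have hle := Finset.single_le_sum hterm (Finset.mem_univ j)
          rw [Set.indicator_of_mem
            (show z ∈ Metric.closedBall (a j) ε ×ˢ Set.univ from ⟨hj, Set.mem_univ _⟩)] at hle
          exact sub_nonpos.mpr hle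
    _ = ∫ z in {z | ∀ j, ε < dist z.1 (a j)}, f z := integral_indicator hA

lemma measurableSet_Dset (d s : ℕ) (ε : ℝ) : MeasurableSet (Dset d s ε) := by
  simp only [Dset, Set.ofPred_forall]
  exact MeasurableSet.iInter fun i => MeasurableSet.iInter fun j => MeasurableSet.iInter fun _ =>
    measurableSet_lt measurable_const
      ((measurable_pi_apply i).fst.dist (measurable_pi_apply j).fst)

lemma cons_mem_Dset_iff {d s : ℕ} {ε : ℝ} {z : Rd d × Rd d} {W : Fin s → Rd d × Rd d} :
    (Fin.cons z W : Fin (s + 1) → Rd d × Rd d) ∈ Dset d (s + 1) ε ↔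
      W ∈ Dset d s ε ∧ ∀ j, ε < dist z.1 (W j).1 := by
  simp [Dset, Fin.forall_fin_succ, and_comm]

lemma integrable_prod_apply {d : ℕ} (s : ℕ) {f : Rd d × Rd d → ℝ} (hint : Integrable f) :
    Integrable fun W : Fin s → Rd d × Rd d => ∏ i, f (W i) :=
  Integrable.fintype_prod fun _ => hint

/-- Integrating out one particle expresses the partition function of `s + 1` particles through
the configurations of the other `s`. -/
lemma integrableOn_and_partitionFunction_succ {d : ℕ} (s : ℕ) (ε : ℝ) {f : Rd d × Rd d → ℝ}
    (hint : Integrable f) :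
    IntegrableOn (fun W : Fin s → Rd d × Rd d =>
        (∏ i, f (W i)) * ∫ z in {z | ∀ j, ε < dist z.1 (W j).1}, f z) (Dset d s ε) ∧
      partitionFunction d (s + 1) ε f = ∫ W in Dset d s ε,
        (∏ i, f (W i)) * ∫ z in {z | ∀ j, ε < dist z.1 (W j).1}, f z := by
  have hsf : SigmaFinite (volume : Measure (Rd d × Rd d)) :=
    inferInstanceAs (SigmaFinite
      ((volume : Measure (Rd d)).prod (volume : Measure (Rd d))))
  let e := MeasurableEquiv.piFinSuccAbove (fun _ : Fin (s + 1) => Rd d × Rd d) 0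
  have he : MeasurePreserving e.symm :=
    (volume_preserving_piFinSuccAbove (fun _ : Fin (s + 1) => Rd d × Rd d) 0).symm _
  let G := (Dset d (s + 1) ε).indicator fun Z => ∏ i, f (Z i)
  have hG : Integrable G := (integrable_prod_apply _ hint).indicator (measurableSet_Dset _ _ _)
  have hGe : Integrable (fun p => G (e.symm p))
      ((volume : Measure (Rd d × Rd d)).prod (volume : Measure (Fin s → Rd d × Rd d))) :=
    he.integrable_comp_of_integrable hG
  have hsection : ∀ W : Fin s → Rd d × Rd d, ∫ z, G (e.symm (z, W)) =
      (Dset d s ε).indicator (fun W => (∏ i, f (W i)) *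
        ∫ z in {z | ∀ j, ε < dist z.1 (W j).1}, f z) W := by
    intro W
    have hA : MeasurableSet {z : Rd d × Rd d | ∀ j, ε < dist z.1 (W j).1} := by
      simp only [Set.ofPred_forall]
      exact MeasurableSet.iInter fun j =>
        measurableSet_lt measurable_const (measurable_fst.dist measurable_const)
    have hcons : ∀ z, e.symm (z, W) = (Fin.cons z W : Fin (s + 1) → Rd d × Rd d) := fun z => Fin.insertNth_zero' z W
    by_cases hW : W ∈ Dset d s ε
    · rw [Set.indicator_of_mem hW, ← integral_indicator hA, ← integral_const_mul]
      refine integral_congr_ae (.of_forall fun z => ?_)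
      simp only [G, hcons, Set.indicator, cons_mem_Dset_iff, hW, true_and, Set.mem_ofPred_eq]
      split_ifs
      · simp [Fin.prod_univ_succ, mul_comm]
      · simp
    · rw [Set.indicator_of_notMem hW]
      simp [G, hcons, cons_mem_Dset_iff, hW]
  refine ⟨?_, ?_⟩
  · rw [← integrable_indicator_iff (measurableSet_Dset _ _ _)]
    simpa only [hsection] using hGe.integral_prod_right
  · calc partitionFunction d (s + 1) ε f = ∫ Z, G Z :=
          (integral_indicator (measurableSet_Dset _ _ _)).symm
      _ = ∫ p, G (e.symm p) := (he.integral_comp e.symm.measurableEmbedding G).symm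
      _ = ∫ W, ∫ z, G (e.symm (z, W)) := integral_prod_symm _ hGe
      _ = _ := by
          simp only [hsection]
          exact integral_indicator (measurableSet_Dset _ _ _)

/-- **Monotonicity of partition functions (Lemma 12.1).** In the Boltzmann–Grad scaling
`N ε^{d−1} = ℓ⁻¹`, for a probability density `f₀` with `‖f₀‖_{L^∞_x L^1_v} ≤ M`, one has
`𝒵_{s+1} ≥ 𝒵_s (1 − ℓ⁻¹ |B_1^d| M ε)` for all `1 ≤ s < N`. -/
theorem partition_function_monotonicity
    (d N : ℕ) (hd : 2 ≤ d) (ℓ ε M : ℝ) (hℓ : 0 < ℓ) (hε : 0 < ε)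
    (hscale : (N : ℝ) * ε ^ (d - 1) = ℓ⁻¹)
    (f₀ : Rd d × Rd d → ℝ) (hmeas : Measurable f₀) (hnn : ∀ z, 0 ≤ f₀ z)
    (hint : Integrable f₀) (hmass : ∫ z, f₀ z = 1)
    (hM : ∀ᵐ x : Rd d, (∫ v : Rd d, f₀ (x, v)) ≤ M)
    (s : ℕ) (hs : 1 ≤ s) (hsN : s < N) :
    partitionFunction d s ε f₀ * (1 - ℓ⁻¹ * unitBallVol d * M * ε)
      ≤ partitionFunction d (s + 1) ε f₀ := by
  have hMnn : 0 ≤ M := by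
    obtain ⟨x, hx⟩ := hM.exists
    exact (integral_nonneg fun v => hnn (x, v)).trans hx
  have hvol : 0 ≤ unitBallVol d := ENNReal.toReal_nonneg
  have hcoef : (s : ℝ) * (M * (ε ^ d * unitBallVol d)) ≤ ℓ⁻¹ * unitBallVol d * M * ε := by
    have hsN' : (s : ℝ) ≤ N := by exact_mod_cast hsN.le
    have hpow : ε ^ d = ε ^ (d - 1) * ε := by
      rw [← pow_succ, Nat.sub_add_cancel (by omega)]
    calc (s : ℝ) * (M * (ε ^ d * unitBallVol d))
        ≤ N * (M * (ε ^ d * unitBallVol d)) := by gcongr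
      _ = ℓ⁻¹ * unitBallVol d * M * ε := by rw [← hscale, hpow]; ring
  obtain ⟨hsucc_int, hsucc⟩ := integrableOn_and_partitionFunction_succ s ε hint
  rw [hsucc, partitionFunction, ← integral_mul_const]
  refine integral_mono ((integrable_prod_apply s hint).integrableOn.mul_const _) hsucc_int ?_
  intro W
  refine mul_le_mul_of_nonneg_left ?_ (Finset.prod_nonneg fun i _ => hnn (W i))
  exact (sub_le_sub_left hcoef 1).trans
    (le_setIntegral_forall_lt_dist hε hnn hint hmass hM fun j => (W j).1)
end
end
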